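/- arXiv:2404.17919 — 2 statements merged into one kernel-verified Lean document; each statement's English description precedes it below -/
import Mathlib

section
/- For every subset J ⊆ {1,…,n}, the set of monomials M(J) = {x_1^{a_1}⋯x_n^{a_n} : a_i < st(J)_i for all 1 ≤ i ≤ n} descends to a K-vector space basis of the quotient ring S/((S^{S_n}_+) : f_J). (In particular, when 1 ∈ J this colon ideal is the unit ideal and the quotient is zero.) -/
open MvPolynomial

noncomputable section

def coinvIdeal (K : Type*) [Field K] (n : ℕ) : Ideal (MvPolynomial (Fin n) K) :=
  Ideal.span {f | f.IsSymmetric ∧ constantCoeff f = 0}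

def stair {n : ℕ} (J : Finset (Fin n)) (i : Fin n) : ℕ :=
  (Finset.univ.filter fun k : Fin n => k ≤ i ∧ k ∉ J).card

def fJ (K : Type*) [Field K] (n : ℕ) (J : Finset (Fin n)) : MvPolynomial (Fin n) K :=
  ∏ j ∈ J, (X j * ∏ i ∈ Finset.univ.filter fun i => j < i, (X j - X i))

set_option linter.unusedSectionVars false

section Spanning

variable {K R ι : Type*} [Field K] [CharZero K] [CommRing R] [Algebra K R] [LinearOrder ι]

/-- Span of the monomials in `x i`, `i ∈ V`, with exponents below `h`. -/
def monsSp (K : Type*) {R ι : Type*} [Field K] [CommRing R] [Algebra K R]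
    (x : ι → R) (V : Finset ι) (h : ι → ℕ) : Submodule K R :=
  Submodule.span K {y | ∃ a : ι → ℕ, (∀ i ∈ V, a i < h i) ∧ y = ∏ i ∈ V, x i ^ a i}

def GenBy (K : Type*) {R ι : Type*} [Field K] [CommRing R] [Algebra K R]
    (x : ι → R) (V : Finset ι) (Q : Ideal R) : Prop :=
  ∀ r : R, ∃ p ∈ Algebra.adjoin K (x '' (V : Set ι)), r - p ∈ Q

def SpnBy (K : Type*) {R ι : Type*} [Field K] [CommRing R] [Algebra K R]
    (x : ι → R) (V : Finset ι) (h : ι → ℕ) (Q : Ideal R) : Prop :=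
  ∀ r : R, ∃ p ∈ monsSp K x V h, r - p ∈ Q

def colE {R : Type*} [CommRing R] (Q : Ideal R) (f : R) : Ideal R := Submodule.colon Q {f}

lemma mem_colE {R : Type*} [CommRing R] {Q : Ideal R} {f g : R} : g ∈ colE Q f ↔ g * f ∈ Q := by
  simp [colE, Submodule.mem_colon_singleton]

lemma le_colE {R : Type*} [CommRing R] {Q : Ideal R} {f : R} : Q ≤ colE Q f := fun g hg =>
  mem_colE.2 (Q.mul_mem_right _ hg)

lemma GenBy.mono' {x : ι → R} {V V' : Finset ι} {Q Q' : Ideal R} (h : GenBy K x V Q)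
    (hQ : Q ≤ Q') (hx : ∀ i ∈ V, ∃ p ∈ Algebra.adjoin K (x '' (V' : Set ι)), x i - p ∈ Q') :
    GenBy K x V' Q' := by
  intro r
  obtain ⟨p, hp, hr⟩ := h r
  have key : ∃ q ∈ Algebra.adjoin K (x '' (V' : Set ι)), p - q ∈ Q' := by
    clear hr
    induction hp using Algebra.adjoin_induction with
    | mem y hy =>
      obtain ⟨i, hi, rfl⟩ := hy
      exact hx i hi
    | algebraMap k => exact ⟨_, Subalgebra.algebraMap_mem _ k, by simp⟩
    | add a b _ _ ha hb =>
      obtain ⟨a', ha, ha'⟩ := ha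
      obtain ⟨b', hb, hb'⟩ := hb
      exact ⟨a' + b', add_mem ha hb, by
        have := Q'.add_mem ha' hb'
        convert this using 1; ring⟩
    | mul a b _ _ ha hb =>
      obtain ⟨a', ha, ha'⟩ := ha
      obtain ⟨b', hb, hb'⟩ := hb
      exact ⟨a' * b', mul_mem ha hb, by
        have := Q'.add_mem (Q'.mul_mem_right b ha') (Q'.mul_mem_left a' hb')
        convert this using 1; ring⟩
  obtain ⟨q, hq, hpq⟩ := key
  exact ⟨q, hq, by
    have := Q'.add_mem (hQ hr) hpq
    convert this using 1; ring⟩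

lemma GenBy.mono {x : ι → R} {V : Finset ι} {Q Q' : Ideal R} (h : GenBy K x V Q)
    (hQ : Q ≤ Q') : GenBy K x V Q' :=
  h.mono' hQ fun i hi => ⟨x i, Algebra.subset_adjoin ⟨i, hi, rfl⟩, by simp⟩

lemma GenBy.erase {x : ι → R} {V : Finset ι} {Q Q' : Ideal R} (h : GenBy K x V Q)
    (hQ : Q ≤ Q') (e : ι) (he : x e ∈ Q') : GenBy K x (V.erase e) Q' :=
  h.mono' hQ fun i hi => by
    by_cases hie : i = e
    · exact ⟨0, zero_mem _, by simpa [hie] using he⟩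
    · exact ⟨x i, Algebra.subset_adjoin ⟨i, by simp [hie]; exact hi, rfl⟩, by simp⟩

lemma SpnBy.congr {x : ι → R} {V : Finset ι} {h h' : ι → ℕ} {Q : Ideal R}
    (hs : SpnBy K x V h Q) (hh : ∀ i ∈ V, h i = h' i) : SpnBy K x V h' Q := by
  intro r
  obtain ⟨p, hp, hr⟩ := hs r
  refine ⟨p, ?_, hr⟩
  refine Submodule.span_mono ?_ hp
  rintro y ⟨a, ha, rfl⟩
  exact ⟨a, fun i hi => hh i hi ▸ ha i hi, rfl⟩

lemma SpnBy.mono {x : ι → R} {V : Finset ι} {h : ι → ℕ} {Q Q' : Ideal R}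
    (hs : SpnBy K x V h Q) (hQ : Q ≤ Q') : SpnBy K x V h Q' := by
  intro r
  obtain ⟨p, hp, hr⟩ := hs r
  exact ⟨p, hp, hQ hr⟩

lemma spn_step {x : ι → R} {V : Finset ι} {h h' : ι → ℕ} {Q : Ideal R} {e : ι} (he : e ∈ V)
    (hhe : h e = h' e + 1) (hh : ∀ i ∈ V, i ≠ e → h i = h' i)
    (h1 : SpnBy K x (V.erase e) h (Q ⊔ Ideal.span {x e}))
    (h2 : SpnBy K x V h' (colE Q (x e))) : SpnBy K x V h Q := by
  intro r
  obtain ⟨p, hp, hr⟩ := h1 r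
  obtain ⟨q, hq, s, hs, hqs⟩ := Submodule.mem_sup.1 hr
  obtain ⟨s, rfl⟩ := Ideal.mem_span_singleton'.1 hs
  obtain ⟨m, hm, hsm⟩ := h2 s
  rw [mem_colE] at hsm
  refine ⟨p + m * x e, add_mem ?_ ?_, ?_⟩
  · refine Submodule.span_mono ?_ hp
    rintro y ⟨a, ha, rfl⟩
    refine ⟨Function.update a e 0, ?_, ?_⟩
    · intro i hi
      by_cases hie : i = e
      · subst hie; simp [hhe]
      · simpa [hie] using ha i (by simp [hie, hi])
    · rw [← Finset.mul_prod_erase V _ he]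
      simp only [Function.update_self, pow_zero, one_mul]
      refine Finset.prod_congr rfl fun i hi => ?_
      rw [Function.update_of_ne (Finset.ne_of_mem_erase hi)]
  · have : monsSp K x V h' ≤ (monsSp K x V h).comap (LinearMap.mulRight K (x e)) := by
      refine Submodule.span_le.2 ?_
      rintro y ⟨a, ha, rfl⟩
      refine Submodule.subset_span ⟨Function.update a e (a e + 1), ?_, ?_⟩
      · intro i hi
        by_cases hie : i = e
        · subst hie; simpa [hhe] using ha _ hi
        · simpa [hie, hh i hi hie] using ha i hi
      · rw [← Finset.mul_prod_erase V _ he, ← Finset.mul_prod_erase V _ he]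
        simp only [Function.update_self, LinearMap.mulRight_apply]
        have : ∏ i ∈ V.erase e, x i ^ (Function.update a e (a e + 1) i)
            = ∏ i ∈ V.erase e, x i ^ a i :=
          Finset.prod_congr rfl fun i hi => by
            rw [Function.update_of_ne (Finset.ne_of_mem_erase hi)]
        rw [this]; ring
    exact this hm
  · have := Q.add_mem hq hsm
    convert this using 1
    linear_combination -hqs

/-- Column heights. -/
def hgt (C P : Finset ι) (i : ι) : ℕ := (C.filter (· < i)).card + if i ∈ P then 1 else 0

/-- The product of `x j - x c` over `c ∈ C`, `c < j`. -/
def lowProd (x : ι → R) (C : Finset ι) (j : ι) : R := ∏ c ∈ C.filter (· < j), (x j - x c)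

def ClassOne (K : Type*) {R ι : Type*} [Field K] [CommRing R] [Algebra K R] [LinearOrder ι]
    (x : ι → R) (V : Finset ι) : Prop :=
  ∀ (C E : Finset ι) (w : ι → ℕ) (Q : Ideal R), C ⊆ V → E ⊆ V → Disjoint C E →
    (∀ i ∈ V, 0 < w i) → (∀ k, ∑ i ∈ V, (w i : R) * x i ^ (k + 1) ∈ Q) →
    (∀ j ∈ V, j ∉ C → j ∉ E → lowProd x C j ∈ Q) →
    (∀ j ∈ E, x j * lowProd x C j ∈ Q) → GenBy K x V Q → SpnBy K x V (hgt C (C ∪ E)) Q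

def ClassTwo (K : Type*) {R ι : Type*} [Field K] [CommRing R] [Algebra K R] [LinearOrder ι]
    (x : ι → R) (V : Finset ι) : Prop :=
  ∀ (C B : Finset ι) (w : ι → ℕ) (Q : Ideal R), C ⊆ V → B ⊆ C →
    (∀ b ∈ B, ∀ c ∈ C, c < b → c ∈ B) →
    (∀ i ∈ V, 0 < w i) → (∀ k, ∑ i ∈ V, (w i : R) * x i ^ (k + 1) ∈ Q) →
    (∀ j ∈ V, j ∉ C → lowProd x C j ∈ Q) →
    (∑ m ∈ V, (w m : R) * ∏ b ∈ B, (x m - x b) ∈ Q) → GenBy K x V Q → SpnBy K x V (hgt C B) Q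

lemma psum_poly {x : ι → R} {V : Finset ι} {w : ι → ℕ} {Q : Ideal R}
    (hp : ∀ k, ∑ i ∈ V, (w i : R) * x i ^ (k + 1) ∈ Q) (q : Polynomial R) :
    ∑ i ∈ V, (w i : R) * (x i * q.eval (x i)) ∈ Q := by
  induction q using Polynomial.induction_on' with
  | add p q hp hq =>
    have := Q.add_mem hp hq
    convert this using 1
    rw [← Finset.sum_add_distrib]
    refine Finset.sum_congr rfl fun i _ => ?_
    rw [Polynomial.eval_add]; ring
  | monomial k a =>
    have := Q.mul_mem_left a (hp k)
    convert this using 1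
    rw [Finset.mul_sum]
    refine Finset.sum_congr rfl fun i _ => ?_
    rw [Polynomial.eval_monomial]; ring

lemma lowProd_congr (x : ι → R) {C C' : Finset ι} {j : ι}
    (h : ∀ c, c < j → (c ∈ C ↔ c ∈ C')) : lowProd x C j = lowProd x C' j := by
  unfold lowProd
  congr 1
  ext c
  simp only [Finset.mem_filter]
  constructor
  · rintro ⟨a, b⟩; exact ⟨(h c b).1 a, b⟩
  · rintro ⟨a, b⟩; exact ⟨(h c b).2 a, b⟩

lemma classTwo_of {x : ι → R} {V : Finset ι} (ih : ∀ e ∈ V, ClassOne K x (V.erase e)) :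
    ClassTwo K x V := by
  intro C B
  induction B using Finset.induction_on_max with
  | empty =>
    intro w Q hCV _ _ hw hp hJ hB hg
    rcases V.eq_empty_or_nonempty with rfl | hV
    · intro r
      obtain ⟨p, hp, hr⟩ := hg r
      refine ⟨p, ?_, hr⟩
      simp only [Finset.coe_empty, Set.image_empty, Algebra.adjoin_empty] at hp
      obtain ⟨k, rfl⟩ := Algebra.mem_bot.1 hp
      rw [Algebra.algebraMap_eq_smul_one]
      exact Submodule.smul_mem _ _ (Submodule.subset_span ⟨0, by simp, by simp⟩)
    · have h1 : (1 : R) ∈ Q := by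
        have hpos : 0 < ∑ m ∈ V, w m := Finset.sum_pos hw hV
        have hne : ((∑ m ∈ V, w m : ℕ) : K) ≠ 0 := by exact_mod_cast hpos.ne'
        have := Q.mul_mem_left (algebraMap K R ((∑ m ∈ V, w m : ℕ) : K)⁻¹) hB
        convert this using 1
        simp only [Finset.prod_empty, mul_one]
        rw [← Nat.cast_sum, ← map_natCast (algebraMap K R), ← map_mul, inv_mul_cancel₀ hne, map_one]
      intro r
      exact ⟨0, zero_mem _, by simpa using Q.mul_mem_left r h1⟩
  | insert b B hmax ihB =>
    intro w Q hCV hBC hlow hw hp hJ hB hg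
    have hbB : b ∉ B := fun h => lt_irrefl _ (hmax b h)
    have hbC : b ∈ C := hBC (Finset.mem_insert_self _ _)
    have hbV := hCV hbC
    refine spn_step (h' := hgt C B) hbV ?_ ?_ ?_ ?_
    · simp [hgt, hbB]
    · intro i _ hib
      simp [hgt, hib]
    · have hle : Q ≤ Q ⊔ Ideal.span {x b} := le_sup_left
      have hxb : x b ∈ Q ⊔ Ideal.span {x b} :=
        Ideal.mem_sup_right (Ideal.mem_span_singleton_self _)
      refine (ih b hbV (C.erase b) ((V \ C).filter (b < ·)) w (Q ⊔ Ideal.span {x b}) ?_ ?_ ?_ ?_ ?_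
        ?_ ?_ (hg.erase hle b hxb)).congr ?_
      · exact Finset.erase_subset_erase _ hCV
      · intro i
        simp only [Finset.mem_filter, Finset.mem_sdiff, Finset.mem_erase]
        rintro ⟨⟨h1, h2⟩, h3⟩
        exact ⟨h3.ne', h1⟩
      · rw [Finset.disjoint_left]
        intro i
        simp only [Finset.mem_filter, Finset.mem_sdiff, Finset.mem_erase]
        tauto
      · intro i hi; exact hw i (Finset.mem_of_mem_erase hi)
      · intro k
        have h1 := hle (hp k)
        rw [← Finset.add_sum_erase V _ hbV] at h1
        refine (Ideal.add_mem_iff_right _ ?_).1 h1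
        exact Ideal.mul_mem_left _ _ (Ideal.pow_mem_of_mem _ hxb _ (Nat.succ_pos _))
      · intro j hj hjC hjE
        simp only [Finset.mem_filter, Finset.mem_sdiff, Finset.mem_erase] at hj hjC hjE
        have hjC' : j ∉ C := fun h => hjC ⟨hj.1, h⟩
        have hjb : j < b := by
          rcases lt_trichotomy j b with h | h | h
          · exact h
          · exact absurd h hj.1
          · exact absurd ⟨⟨hj.2, hjC'⟩, h⟩ hjE
        rw [lowProd_congr x (C' := C)]
        · exact hle (hJ j hj.2 hjC')
        · intro c hc
          simp [(hc.trans hjb).ne]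
      · intro j hj
        simp only [Finset.mem_filter, Finset.mem_sdiff] at hj
        have h1 := hle (hJ j hj.1.1 hj.1.2)
        have h2 : lowProd x C j = (x j - x b) * lowProd x (C.erase b) j := by
          unfold lowProd
          rw [← Finset.mul_prod_erase (C.filter (· < j)) _ (a := b) (by simp [hbC, hj.2]),
            Finset.filter_erase]
        have h3 := Ideal.add_mem _ h1 (Ideal.mul_mem_right (lowProd x (C.erase b) j) _ hxb)
        rw [h2] at h3
        convert h3 using 1
        ring
      · intro i hi
        simp only [Finset.mem_erase] at hi
        simp only [hgt, Finset.mem_union, Finset.mem_filter, Finset.mem_sdiff, Finset.mem_erase,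
          Finset.mem_insert, hi.1, hi.2, ne_eq, not_false_eq_true, true_and, false_or]
        rcases lt_or_gt_of_ne hi.1 with h | h
        · have e1 : (C.erase b).filter (· < i) = C.filter (· < i) := by
            ext c
            simp only [Finset.mem_filter, Finset.mem_erase]
            constructor
            · tauto
            · rintro ⟨h1, h2⟩
              exact ⟨⟨(h2.trans h).ne, h1⟩, h2⟩
          have e2 : i ∈ C ↔ i ∈ B := by
            constructor
            · intro hc
              have := hlow b (Finset.mem_insert_self _ _) i hc h
              simpa [hi.1] using this
            · intro hb; exact hBC (Finset.mem_insert_of_mem hb)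
          simp [e1, e2, h.not_gt]
        · have e1 : (C.erase b).filter (· < i) = (C.filter (· < i)).erase b := by
            rw [Finset.filter_erase]
          have e2 : i ∉ B := fun hb => (hmax i hb).not_gt h
          rw [e1]
          have := Finset.card_erase_add_one (s := C.filter (· < i)) (a := b) (by simp [hbC, h])
          simp only [h, e2, and_true, if_false]
          rw [if_pos (by tauto)]
          omega
    · refine ihB w (colE Q (x b)) hCV (fun i hi => hBC (Finset.mem_insert_of_mem hi)) ?_ hw
        (fun k => le_colE (hp k)) (fun j h1 h2 => le_colE (hJ j h1 h2)) ?_ (hg.mono le_colE)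
      · intro b' hb' c hc hcb
        have := hlow b' (Finset.mem_insert_of_mem hb') c hc hcb
        rcases Finset.mem_insert.1 this with rfl | h
        · exact absurd (hmax b' hb') hcb.not_gt
        · exact h
      · rw [mem_colE]
        have h1 := psum_poly hp (∏ c ∈ B, (Polynomial.X - Polynomial.C (x c)))
        have h2 := Q.sub_mem h1 hB
        convert h2 using 1
        rw [Finset.sum_mul, ← Finset.sum_sub_distrib]
        refine Finset.sum_congr rfl fun m _ => ?_
        rw [Finset.prod_insert hbB, Polynomial.eval_prod]
        simp only [Polynomial.eval_sub, Polynomial.eval_X, Polynomial.eval_C]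
        ring

lemma classOne_of {x : ι → R} {V : Finset ι} (ih : ∀ e ∈ V, ClassOne K x (V.erase e))
    (h2 : ClassTwo K x V) : ClassOne K x V := by
  intro C E
  induction E using Finset.induction_on with
  | empty =>
    intro w Q hCV _ _ hw hp hJ _ hg
    rw [Finset.union_empty]
    refine h2 C C w Q hCV subset_rfl (fun b _ c hc _ => hc) hw hp
      (fun j h1 h2 => hJ j h1 h2 (by simp)) ?_ hg
    refine Ideal.sum_mem _ fun m hm => Ideal.mul_mem_left _ _ ?_
    by_cases hmC : m ∈ C
    · rw [Finset.prod_eq_zero hmC (by simp)]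
      exact zero_mem _
    · refine Ideal.mem_of_dvd _ ?_ (hJ m hm hmC (by simp))
      exact Finset.prod_dvd_prod_of_subset _ _ _ (Finset.filter_subset _ _)
  | insert e E heE ihE =>
    intro w Q hCV hEV hd hw hp hJ hE hg
    have heV := hEV (Finset.mem_insert_self _ _)
    have hEV' : E ⊆ V := fun i hi => hEV (Finset.mem_insert_of_mem hi)
    have heC : e ∉ C := fun h => Finset.disjoint_left.1 hd h (Finset.mem_insert_self _ _)
    have hd' : Disjoint C E := hd.mono_right (Finset.subset_insert _ _)
    refine spn_step (h' := hgt C (C ∪ E)) heV ?_ ?_ ?_ ?_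
    · simp [hgt, heE, heC]
    · intro i _ hie
      simp [hgt, hie]
    · have hle : Q ≤ Q ⊔ Ideal.span {x e} := le_sup_left
      have hxe : x e ∈ Q ⊔ Ideal.span {x e} :=
        Ideal.mem_sup_right (Ideal.mem_span_singleton_self _)
      refine (ih e heV C E w _ ?_ ?_ hd' ?_ ?_ ?_ ?_ (hg.erase hle e hxe)).congr ?_
      · exact fun i hi => Finset.mem_erase.2 ⟨fun h => heC (h ▸ hi), hCV hi⟩
      · exact fun i hi => Finset.mem_erase.2 ⟨fun h => heE (h ▸ hi), hEV' hi⟩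
      · intro i hi; exact hw i (Finset.mem_of_mem_erase hi)
      · intro k
        have h1 := hle (hp k)
        rw [← Finset.add_sum_erase V _ heV] at h1
        refine (Ideal.add_mem_iff_right _ ?_).1 h1
        exact Ideal.mul_mem_left _ _ (Ideal.pow_mem_of_mem _ hxe _ (Nat.succ_pos _))
      · intro j hj hjC hjE
        rw [Finset.mem_erase] at hj
        exact hle (hJ j hj.2 hjC (by simp [hj.1, hjE]))
      · intro j hj
        exact hle (hE j (Finset.mem_insert_of_mem hj))
      · intro i hi
        rw [Finset.mem_erase] at hi
        simp [hgt, hi.1]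
    · refine ihE w _ hCV hEV' hd' hw (fun k => le_colE (hp k)) ?_
        (fun j hj => le_colE (hE j (Finset.mem_insert_of_mem hj))) (hg.mono le_colE)
      intro j hj hjC hjE
      by_cases hje : j = e
      · subst hje
        rw [mem_colE, mul_comm]
        exact hE j (Finset.mem_insert_self _ _)
      · exact le_colE (hJ j hj hjC (by simp [hje, hjE]))

theorem classOne_all (x : ι → R) (V : Finset ι) : ClassOne K x V := by
  induction V using Finset.strongInduction with
  | H V ih =>
    have h : ∀ e ∈ V, ClassOne K x (V.erase e) := fun e he => ih _ (Finset.erase_ssubset he)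
    exact classOne_of h (classTwo_of h)

end Spanning
section Tower

open Polynomial in
lemma exists_split_algebra.{u} (n : ℕ) : ∀ (A : Type u) [CommRing A] [Nontrivial A] (f : A[X]),
    f.Monic → f.natDegree = n →
    ∃ (B : Type u) (_ : CommRing B) (_ : Algebra A B), Nontrivial B ∧ Module.Free A B ∧
      Module.Finite A B ∧ Module.finrank A B = n.factorial ∧
      ∃ x : Fin n → B, f.map (algebraMap A B) = ∏ i, (Polynomial.X - Polynomial.C (x i)) ∧
        Algebra.adjoin A (Set.range x) = ⊤ := by
  induction n with
  | zero =>
    intro A _ _ f hf hn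
    refine ⟨A, inferInstance, inferInstance, inferInstance, inferInstance, inferInstance, by simp,
      Fin.elim0, ?_, ?_⟩
    · rw [hf.natDegree_eq_zero.1 hn]; simp
    · have : (⊥ : Subalgebra A A) = ⊤ := by
        rw [eq_top_iff]; intro a _; exact Algebra.mem_bot.2 ⟨a, rfl⟩
      simp [this]
  | succ n ih =>
    intro A _ _ f hf hn
    have : Module.Free A (AdjoinRoot f) := hf.free_adjoinRoot
    have : Module.Finite A (AdjoinRoot f) := hf.finite_adjoinRoot
    have hfr : Module.finrank A (AdjoinRoot f) = n + 1 := by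
      rw [(AdjoinRoot.powerBasis' hf).finrank, AdjoinRoot.powerBasis'_dim, hn]
    have : Nontrivial (AdjoinRoot f) :=
      Module.nontrivial_of_finrank_pos (R := A) (by rw [hfr]; omega)
    have hroot : (f.map (algebraMap A (AdjoinRoot f))).IsRoot (AdjoinRoot.root f) := by
      rw [IsRoot, Polynomial.eval_map]; exact AdjoinRoot.eval₂_root f
    obtain ⟨g, hg⟩ := dvd_iff_isRoot.2 hroot
    have hgm : g.Monic := by
      have h1 : (f.map (algebraMap A (AdjoinRoot f))).Monic := hf.map _
      rw [hg] at h1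
      exact (monic_X_sub_C _).of_mul_monic_left h1
    have hgd : g.natDegree = n := by
      have h1 : (f.map (algebraMap A (AdjoinRoot f))).natDegree = n + 1 := by
        rw [hf.natDegree_map, hn]
      rw [hg, (monic_X_sub_C _).natDegree_mul hgm, natDegree_X_sub_C] at h1
      omega
    obtain ⟨B, i1, i2, hB1, hB2, hB3, hB4, x, hx, hadj⟩ := ih (AdjoinRoot f) g hgm hgd
    let : Algebra A B := ((algebraMap (AdjoinRoot f) B).comp (algebraMap A (AdjoinRoot f))).toAlgebra
    have : IsScalarTower A (AdjoinRoot f) B := IsScalarTower.of_algebraMap_eq' rfl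
    refine ⟨B, i1, inferInstance, hB1, Module.Free.trans (S := AdjoinRoot f),
      Module.Finite.trans (AdjoinRoot f) B, ?_,
      Fin.cons (algebraMap _ _ (AdjoinRoot.root f)) x, ?_, ?_⟩
    · rw [← Module.finrank_mul_finrank A (AdjoinRoot f) B, hfr, hB4, Nat.factorial_succ]
    · rw [Fin.prod_univ_succ]
      simp only [Fin.cons_zero, Fin.cons_succ]
      rw [← hx, IsScalarTower.algebraMap_eq A (AdjoinRoot f) B, ← Polynomial.map_map, hg]
      simp
    · rw [eq_top_iff]
      intro b _
      have hb : b ∈ Algebra.adjoin (AdjoinRoot f) (Set.range x) := hadj ▸ trivial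
      induction hb using Algebra.adjoin_induction with
      | mem y hy =>
        obtain ⟨i, rfl⟩ := hy
        exact Algebra.subset_adjoin ⟨i.succ, by simp⟩
      | algebraMap a =>
        obtain ⟨p, rfl⟩ := AdjoinRoot.mk_surjective a
        rw [← AdjoinRoot.aeval_eq, ← Polynomial.aeval_algebraMap_apply, Polynomial.aeval_eq_sum_range]
        refine sum_mem fun i _ => Subalgebra.smul_mem _ (pow_mem ?_ _) _
        exact Algebra.subset_adjoin ⟨0, by simp⟩
      | add a b _ _ ha hb => exact add_mem (ha trivial) (hb trivial)
      | mul a b _ _ ha hb => exact mul_mem (ha trivial) (hb trivial)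

lemma esymm_mem_coinv (K : Type*) [Field K] (n k : ℕ) (hk : k ≠ 0) :
    esymm (Fin n) K k ∈ coinvIdeal K n := by
  refine Ideal.subset_span ⟨esymm_isSymmetric _ _ _, ?_⟩
  rw [esymm, map_sum]
  refine Finset.sum_eq_zero fun s hs => ?_
  rw [map_prod]
  have : s.Nonempty := by
    rw [← Finset.card_pos, (Finset.mem_powersetCard.1 hs).2]; omega
  obtain ⟨i, hi⟩ := this
  exact Finset.prod_eq_zero hi (by simp)

lemma psum_mem_coinv (K : Type*) [Field K] (n k : ℕ) :
    ∑ i, (X i : MvPolynomial (Fin n) K) ^ (k + 1) ∈ coinvIdeal K n := by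
  refine Ideal.subset_span ⟨psum_isSymmetric (Fin n) K (k + 1), ?_⟩
  simp

/-- A ring hom killing the elementary symmetric polynomials kills the coinvariant ideal. -/
lemma coinv_le_ker {K : Type*} [Field K] {n : ℕ} {B : Type*} [CommRing B] [Algebra K B]
    (φ : MvPolynomial (Fin n) K →ₐ[K] B) (h : ∀ k, k ≠ 0 → φ (esymm (Fin n) K k) = 0) :
    coinvIdeal K n ≤ RingHom.ker φ := by
  refine Ideal.span_le.2 ?_
  rintro f ⟨hf, hc⟩
  obtain ⟨p, hp⟩ := esymmAlgHom_surjective (σ := Fin n) (n := n) K (by simp)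
    ⟨f, (mem_symmetricSubalgebra f).2 hf⟩
  have hp' : aeval (fun i : Fin n => esymm (Fin n) K (i + 1)) p = f := by
    rw [← esymmAlgHom_apply, hp]
  have h1 : φ f = algebraMap K B (constantCoeff p) := by
    rw [← hp', ← AlgHom.comp_apply, comp_aeval]
    have : (fun i : Fin n => φ (esymm (Fin n) K (i + 1))) = fun _ => 0 := by
      funext i; exact h _ (Nat.succ_ne_zero _)
    rw [this]
    exact aeval_zero' p
  have h2 : constantCoeff f = constantCoeff p := by
    rw [← hp']
    have h0 : ∀ i : Fin n, constantCoeff (esymm (Fin n) K (i + 1)) = 0 := by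
      intro i
      rw [esymm, map_sum]
      refine Finset.sum_eq_zero fun s hs => ?_
      rw [map_prod]
      have : s.Nonempty := by
        rw [← Finset.card_pos, (Finset.mem_powersetCard.1 hs).2]; omega
      obtain ⟨i, hi⟩ := this
      exact Finset.prod_eq_zero hi (by simp)
    have : (constantCoeff.comp (aeval (fun i : Fin n => esymm (Fin n) K (i + 1))).toRingHom)
        = (constantCoeff : MvPolynomial (Fin n) K →+* K) := by
      refine MvPolynomial.ringHom_ext (fun r => by simp) (fun i => by simpa using h0 i)
    exact RingHom.congr_fun this p
  simp only [SetLike.mem_coe, RingHom.mem_ker]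
  rw [h1, ← h2, hc, map_zero]

lemma multiset_esymm_eq {K : Type*} [Field K] {n : ℕ} {B : Type*} [CommRing B] [Algebra K B]
    (φ : MvPolynomial (Fin n) K →ₐ[K] B) (k : ℕ) :
    (Finset.univ.val.map fun i => φ (X i)).esymm k = φ (esymm (Fin n) K k) := by
  rw [← aeval_esymm_eq_multiset_esymm (Fin n) K]
  exact (DFunLike.congr_fun (aeval_unique φ) _).symm

lemma prod_X_sub_eq {K : Type*} [Field K] {n : ℕ} {B : Type*} [CommRing B] [Algebra K B]
    (φ : MvPolynomial (Fin n) K →ₐ[K] B) (h : ∀ k, k ≠ 0 → φ (esymm (Fin n) K k) = 0) :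
    ∏ i, (Polynomial.X - Polynomial.C (φ (X i))) = Polynomial.X ^ n := by
  have := Multiset.prod_X_sub_X_eq_sum_esymm (Finset.univ.val.map fun i => φ (X i))
  rw [Multiset.map_map] at this
  refine Eq.trans this ?_
  rw [Finset.sum_eq_single 0]
  · rw [multiset_esymm_eq, esymm_zero]; simp
  · intro j _ hj
    rw [multiset_esymm_eq, h j hj]; simp
  · simp

lemma esymm_zero_of_prod {K : Type*} [Field K] {n : ℕ} {B : Type*} [CommRing B] [Algebra K B]
    (φ : MvPolynomial (Fin n) K →ₐ[K] B)
    (h : ∏ i, (Polynomial.X - Polynomial.C (φ (X i))) = Polynomial.X ^ n) :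
     ∀ k, k ≠ 0 → φ (esymm (Fin n) K k) = 0 := by
  intro k hk
  by_cases hkn : k ≤ n
  · have := Multiset.prod_X_sub_C_coeff (Finset.univ.val.map fun i => φ (X i)) (k := n - k) (by simp)
    rw [Multiset.map_map, multiset_esymm_eq] at this
    have h2 : (Polynomial.X ^ n : Polynomial B).coeff (n - k) = 0 := by
      rw [Polynomial.coeff_X_pow, if_neg (by omega)]
    rw [← h] at h2
    have h3 := this.symm.trans h2
    simp only [Multiset.card_map, Finset.card_val, Finset.card_univ, Fintype.card_fin,
      Nat.sub_sub_self hkn] at h3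
    have h4 := congrArg (fun z => (-1) ^ k * z) h3
    simp only [← mul_assoc, ← mul_pow] at h4
    simpa using h4
  · rw [esymm, Finset.powersetCard_eq_empty.2 (by simpa using hkn)]; simp

lemma factorial_le_finrank.{u} (K : Type u) [Field K] (n : ℕ)
    [Module.Finite K (MvPolynomial (Fin n) K ⧸ coinvIdeal K n)] :
    n.factorial ≤ Module.finrank K (MvPolynomial (Fin n) K ⧸ coinvIdeal K n) := by
  obtain ⟨B, i1, i2, hB1, hB2, hB3, hB4, x, hx, hadj⟩ := exists_split_algebra n K
    (Polynomial.X ^ n) (Polynomial.monic_X_pow n) (Polynomial.natDegree_X_pow n)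
  have hφ := coinv_le_ker (aeval x : MvPolynomial (Fin n) K →ₐ[K] B)
    (esymm_zero_of_prod _ (by simpa using hx.symm))
  have hsurj : Function.Surjective (aeval x : MvPolynomial (Fin n) K →ₐ[K] B) := by
    rw [← AlgHom.range_eq_top, ← Algebra.adjoin_range_eq_range_aeval, hadj]
  rw [← hB4]
  refine LinearMap.finrank_le_finrank_of_surjective
    (f := (Ideal.Quotient.liftₐ (coinvIdeal K n) (aeval x) hφ).toLinearMap) ?_
  intro b
  obtain ⟨p, rfl⟩ := hsurj b
  exact ⟨Ideal.Quotient.mk _ p, rfl⟩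

/-- `x_j ∏_{i ≠ j} (x_j - x_i)` lies in the coinvariant ideal. -/
lemma full_mem_coinv (K : Type*) [Field K] (n : ℕ) (j : Fin n) :
    X j * ∏ i ∈ Finset.univ.erase j, (X j - X i) ∈ coinvIdeal K n := by
  have hP := prod_X_sub_eq (Ideal.Quotient.mkₐ K (coinvIdeal K n)) (fun k hk => by
    rw [Ideal.Quotient.mkₐ_eq_mk, Ideal.Quotient.eq_zero_iff_mem]; exact esymm_mem_coinv K n k hk)
  rw [← Ideal.Quotient.eq_zero_iff_mem]
  set y : Fin n → MvPolynomial (Fin n) K ⧸ coinvIdeal K n :=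
    fun i => Ideal.Quotient.mkₐ K (coinvIdeal K n) (X i) with hy
  have h1 : y j ^ n = 0 := by
    have := congrArg (Polynomial.eval (y j)) hP
    rw [Polynomial.eval_prod, Finset.prod_eq_zero (Finset.mem_univ j) (by simp [hy])] at this
    simpa using this.symm
  have h2 : ∏ i ∈ Finset.univ.erase j, (y j - y i) = n * y j ^ (n - 1) := by
    have := congrArg (fun p => Polynomial.eval (y j) (Polynomial.derivative p)) hP
    rw [← Finset.mul_prod_erase _ _ (Finset.mem_univ j)] at this
    simpa [Polynomial.derivative_mul, Polynomial.eval_prod, Polynomial.derivative_X_pow, hy] using this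
  have hn : n - 1 + 1 = n := Nat.sub_add_cancel j.pos
  calc _ = y j * ∏ i ∈ Finset.univ.erase j, (y j - y i) := by
          simp [hy, map_prod]
    _ = n * y j ^ (n - 1 + 1) := by rw [h2]; ring
    _ = 0 := by rw [hn, h1, mul_zero]

end Tower
section Dim

variable {K R ι : Type*} [Field K] [CharZero K] [CommRing R] [Algebra K R] [LinearOrder ι]

lemma SpnBy.finrank_le {x : ι → R} {V : Finset ι} {h : ι → ℕ} {Q : Ideal R}
    (hs : SpnBy K x V h Q) :
    Module.Finite K (R ⧸ Q) ∧ Module.finrank K (R ⧸ Q) ≤ ∏ i ∈ V, h i := by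
  classical
  let T : Finset (R ⧸ Q) := (V.pi fun i => Finset.range (h i)).image
    fun a => Ideal.Quotient.mk Q (∏ i ∈ V.attach, x i.1 ^ a i.1 i.2)
  have hT : Submodule.span K (T : Set (R ⧸ Q)) = ⊤ := by
    rw [eq_top_iff]
    rintro y -
    obtain ⟨r, rfl⟩ := Ideal.Quotient.mk_surjective y
    obtain ⟨p, hp, hr⟩ := hs r
    rw [Ideal.Quotient.eq.2 hr]
    have : monsSp K x V h ≤ (Submodule.span K (T : Set (R ⧸ Q))).comap
        (Ideal.Quotient.mkₐ K Q).toLinearMap := by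
      refine Submodule.span_le.2 ?_
      rintro y ⟨a, ha, rfl⟩
      refine Submodule.subset_span ?_
      simp only [T, Finset.coe_image]
      refine ⟨fun i _ => a i, ?_, ?_⟩
      · simpa using ha
      · simp only [AlgHom.toLinearMap_apply, Ideal.Quotient.mkₐ_eq_mk]
        rw [Finset.prod_attach V (fun i => x i ^ a i)]
    exact this hp
  refine ⟨⟨⟨T, hT⟩⟩, ?_⟩
  rw [← finrank_top, ← hT]
  refine (finrank_span_finset_le_card T).trans (Finset.card_image_le.trans ?_)
  simp [Finset.card_pi]

lemma finrank_le_of_surj {M : Type*} [AddCommGroup M] [Module K M] (I : Ideal R)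
    [Module.Finite K (R ⧸ I)] (f : R →ₗ[K] M) (hf : Function.Surjective f)
    (hI : ∀ r ∈ I, f r = 0) : Module.finrank K M ≤ Module.finrank K (R ⧸ I) := by
  let g : (R ⧸ I.restrictScalars K) →ₗ[K] M :=
    Submodule.liftQ (I.restrictScalars K) f (fun r hr => hI r hr)
  let e : (R ⧸ I.restrictScalars K) ≃ₗ[K] (R ⧸ I) := Submodule.Quotient.restrictScalarsEquiv K I
  refine LinearMap.finrank_le_finrank_of_surjective (f := g ∘ₗ e.symm.toLinearMap) ?_
  intro m
  obtain ⟨r, rfl⟩ := hf m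
  exact ⟨e (Submodule.Quotient.mk r), by
    rw [LinearMap.comp_apply, LinearEquiv.coe_coe, LinearEquiv.symm_apply_apply]; rfl⟩

lemma finite_of_le {Q Q' : Ideal R} (h : Q ≤ Q') [Module.Finite K (R ⧸ Q)] :
    Module.Finite K (R ⧸ Q') :=
  Module.Finite.of_surjective (Ideal.Quotient.factorₐ K h).toLinearMap
    (Ideal.Quotient.factor_surjective h)

lemma finrank_anti {Q Q' : Ideal R} (h : Q ≤ Q') [Module.Finite K (R ⧸ Q)] :
    Module.finrank K (R ⧸ Q') ≤ Module.finrank K (R ⧸ Q) :=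
  LinearMap.finrank_le_finrank_of_surjective (f := (Ideal.Quotient.factorₐ K h).toLinearMap)
    (Ideal.Quotient.factor_surjective h)

lemma finrank_colE (Q : Ideal R) (β : R) [Module.Finite K (R ⧸ Q)] :
    Module.finrank K (R ⧸ Q) ≤ Module.finrank K (R ⧸ colE Q β) +
      Module.finrank K (R ⧸ (Q ⊔ Ideal.span {β})) := by
  have := finite_of_le (K := K) (le_colE (Q := Q) (f := β))
  have := finite_of_le (K := K) (le_sup_left (a := Q) (b := Ideal.span {β}))
  let φ : (R ⧸ Q) →ₗ[K] (R ⧸ Q) := LinearMap.mulLeft K (Ideal.Quotient.mk Q β)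
  let π : R →ₗ[K] (R ⧸ Q) := (Ideal.Quotient.mkₐ K Q).toLinearMap
  have hπ : Function.Surjective π := Ideal.Quotient.mk_surjective
  rw [← Submodule.finrank_quotient_add_finrank (LinearMap.range φ), add_comm]
  refine add_le_add ?_ ?_
  · refine finrank_le_of_surj (colE Q β) (φ.rangeRestrict ∘ₗ π)
      (φ.surjective_rangeRestrict.comp hπ) ?_
    intro r hr
    apply Subtype.ext
    change Ideal.Quotient.mk Q β * Ideal.Quotient.mk Q r = 0
    rw [← map_mul, Ideal.Quotient.eq_zero_iff_mem, mul_comm]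
    exact mem_colE.1 hr
  · refine finrank_le_of_surj (Q ⊔ Ideal.span {β}) ((LinearMap.range φ).mkQ ∘ₗ π)
      ((LinearMap.range φ).mkQ_surjective.comp hπ) ?_
    intro r hr
    obtain ⟨q, hq, s, hs, rfl⟩ := Submodule.mem_sup.1 hr
    obtain ⟨c, rfl⟩ := Ideal.mem_span_singleton.1 hs
    rw [LinearMap.comp_apply, Submodule.mkQ_apply, Submodule.Quotient.mk_eq_zero]
    refine ⟨Ideal.Quotient.mk Q c, ?_⟩
    change Ideal.Quotient.mk Q β * Ideal.Quotient.mk Q c = Ideal.Quotient.mk Q (q + β * c)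
    rw [map_add, Ideal.Quotient.eq_zero_iff_mem.2 hq, zero_add, map_mul]

lemma finrank_colE_prod {τ : Type*} (s : Finset τ) (β : τ → R) (Q : Ideal R) (D : ℕ)
    [Module.Finite K (R ⧸ Q)]
    (hD : ∀ t ∈ s, Module.finrank K (R ⧸ (Q ⊔ Ideal.span {β t})) ≤ D) :
    Module.finrank K (R ⧸ Q) ≤ Module.finrank K (R ⧸ colE Q (∏ t ∈ s, β t)) + s.card * D := by
  classical
  induction s using Finset.induction_on with
  | empty =>
    have : colE Q (∏ t ∈ (∅ : Finset τ), β t) = Q := by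
      ext g; simp [mem_colE]
    rw [this]; simp
  | insert t s ht ih =>
    have h1 := ih fun t ht => hD t (Finset.mem_insert_of_mem ht)
    have h2 := hD t (Finset.mem_insert_self _ _)
    have hle := le_colE (Q := Q) (f := ∏ t ∈ s, β t)
    have := finite_of_le (K := K) hle
    have := finite_of_le (K := K) (le_sup_left (a := Q) (b := Ideal.span {β t}))
    have h3 := finrank_colE (K := K) (colE Q (∏ t ∈ s, β t)) (β t)
    have h4 : colE (colE Q (∏ t ∈ s, β t)) (β t) = colE Q (∏ t ∈ insert t s, β t) := by
      ext g; simp [mem_colE, Finset.prod_insert ht, mul_assoc]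
    rw [h4] at h3
    have h5 := finrank_anti (K := K) (sup_le_sup_right hle (Ideal.span {β t}))
    rw [Finset.card_insert_of_notMem ht]
    nlinarith

end Dim

section Combin

variable {n : ℕ}

lemma hgt_self (C : Finset (Fin n)) (i : Fin n) : hgt C C i = (C.filter (· ≤ i)).card := by
  rw [hgt]
  have : C.filter (· ≤ i) = C.filter (· < i) ∪ C.filter (· = i) := by
    ext k; simp [le_iff_lt_or_eq, ← and_or_left]
  rw [this, Finset.card_union_of_disjoint]
  · rw [Finset.filter_eq']
    split_ifs <;> simp
  · rw [Finset.disjoint_left]; intro a; simp; intros; omega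

lemma hgt_stair (J : Finset (Fin n)) (i : Fin n) : hgt Jᶜ Jᶜ i = stair J i := by
  rw [hgt_self, stair]; congr 1; ext k; simp [and_comm]

lemma stair_insert_lt {J : Finset (Fin n)} {l i : Fin n} (h : i < l) :
    stair (insert l J) i = stair J i := by
  unfold stair; congr 1; ext k
  simp only [Finset.mem_filter, Finset.mem_univ, true_and, Finset.mem_insert, not_or]
  constructor
  · tauto
  · rintro ⟨h1, h2⟩; exact ⟨h1, (h1.trans_lt h).ne, h2⟩

lemma stair_insert_ge {J : Finset (Fin n)} {l i : Fin n} (hl : l ∉ J) (h : l ≤ i) :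
    stair (insert l J) i + 1 = stair J i := by
  unfold stair
  have : (Finset.univ.filter fun k : Fin n => k ≤ i ∧ k ∉ insert l J)
      = (Finset.univ.filter fun k : Fin n => k ≤ i ∧ k ∉ J).erase l := by
    ext k
    simp only [Finset.mem_filter, Finset.mem_univ, true_and, Finset.mem_insert, not_or,
      Finset.mem_erase]
    tauto
  rw [this]
  exact Finset.card_erase_add_one (by simp [hl, h])

lemma stair_ge {J : Finset (Fin n)} {j i : Fin n} (hJ : ∀ k ∈ J, k < j) (h : j ≤ i) :
    stair J i = stair J j + (i - j : ℕ) := by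
  unfold stair
  have : (Finset.univ.filter fun k : Fin n => k ≤ i ∧ k ∉ J)
      = (Finset.univ.filter fun k : Fin n => k ≤ j ∧ k ∉ J) ∪ Finset.Ioc j i := by
    ext k
    simp only [Finset.mem_filter, Finset.mem_univ, true_and, Finset.mem_union, Finset.mem_Ioc]
    constructor
    · rintro ⟨h1, h2⟩
      rcases le_or_gt k j with h3 | h3
      · exact Or.inl ⟨h3, h2⟩
      · exact Or.inr ⟨h3, h1⟩
    · rintro (⟨h1, h2⟩ | ⟨h1, h2⟩)
      · exact ⟨h1.trans h, h2⟩
      · exact ⟨h2, fun h3 => absurd (hJ k h3) h1.not_gt⟩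
  rw [this, Finset.card_union_of_disjoint, Fin.card_Ioc]
  rw [Finset.disjoint_left]
  intro a ha hb
  simp at ha hb
  exact absurd ha.1 hb.1.not_ge

/-- the staircase as a function on `ℕ` -/
def stN (J : Finset (Fin n)) (k : ℕ) : ℕ := if h : k < n then stair J ⟨k, h⟩ else 0

lemma stN_coe (J : Finset (Fin n)) (i : Fin n) : stN J i = stair J i := by
  simp [stN]

lemma prod_erase_stair {J : Finset (Fin n)} {j l : Fin n} (hJ : ∀ k ∈ J, k < j) (h : j ≤ l) :
    ∏ i ∈ Finset.univ.erase l, stair (insert l J) i = ∏ k ∈ Finset.range (n - 1), stN J k := by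
  have hl : l ∉ J := fun hh => absurd (hJ l hh) h.not_gt
  let g : ℕ → ℕ := fun k => if k = l then 1 else if k < l then stN J k else stN J k - 1
  have e1 : ∏ i ∈ Finset.univ.erase l, stair (insert l J) i = ∏ i : Fin n, g i := by
    rw [← Finset.mul_prod_erase Finset.univ (fun i : Fin n => g i) (Finset.mem_univ l)]
    have : g l = 1 := by simp [g]
    rw [this, one_mul]
    refine Finset.prod_congr rfl fun i hi => ?_
    have hne : i ≠ l := Finset.ne_of_mem_erase hi
    have hne' : (i : ℕ) ≠ l := fun hh => hne (Fin.ext hh)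
    simp only [g, if_neg hne', stN_coe]
    split_ifs with h1
    · exact stair_insert_lt h1
    · have := stair_insert_ge hl (i := i) (by rw [Fin.le_def]; omega)
      omega
  rw [e1, ← Finset.prod_range, ← Finset.prod_range_mul_prod_Ico g l.2.le,
    Finset.prod_eq_prod_Ico_succ_bot l.2]
  have : g l = 1 := by simp [g]
  have hn : n - 1 + 1 = n := Nat.sub_add_cancel l.pos
  rw [this, one_mul, ← Finset.prod_range_mul_prod_Ico (stN J) (show (l : ℕ) ≤ n - 1 by omega)]
  congr 1
  · refine Finset.prod_congr rfl fun k hk => ?_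
    have := Finset.mem_range.1 hk
    simp [g, this, this.ne]
  · have hs := Finset.prod_Ico_add' g l (n - 1) 1
    rw [hn] at hs
    rw [← hs]
    refine Finset.prod_congr rfl fun k hk => ?_
    have hk := Finset.mem_Ico.1 hk
    have h1 : k + 1 ≠ l := by omega
    have h2 : ¬ (k + 1 < l) := by omega
    have hj : (j : ℕ) ≤ l := h
    simp only [g, if_neg h1, if_neg h2]
    have a1 := stair_ge hJ (i := ⟨k, by omega⟩) (by rw [Fin.le_def]; simp; omega)
    have a2 := stair_ge hJ (i := ⟨k + 1, by omega⟩) (by rw [Fin.le_def]; simp; omega)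
    rw [← stN_coe] at a1 a2
    simp only at a1 a2
    omega

lemma prod_stair_step {J : Finset (Fin n)} {j : Fin n} (hJ : ∀ k ∈ J, k < j) :
    ∏ i, stair J i = ∏ i, stair (insert j J) i +
      (n - j) * ∏ k ∈ Finset.range (n - 1), stN J k := by
  have hj : j ∉ J := fun hh => absurd (hJ j hh) (lt_irrefl _)
  have hn : n - 1 + 1 = n := Nat.sub_add_cancel j.pos
  rw [← Finset.mul_prod_erase Finset.univ (fun i => stair (insert j J) i) (Finset.mem_univ j),
    prod_erase_stair hJ le_rfl]
  have : ∏ i, stair J i = ∏ k ∈ Finset.range (n - 1 + 1), stN J k := by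
    rw [hn, Finset.prod_range]; simp [stN_coe]
  rw [this, Finset.prod_range_succ]
  have a1 := stair_ge hJ (i := ⟨n - 1, by omega⟩) (by rw [Fin.le_def]; simp; omega)
  rw [← stN_coe] at a1
  simp only at a1
  have a2 := stair_insert_ge hj le_rfl
  have : stN J (n - 1) = stair (insert j J) j + (n - j) := by omega
  rw [this]; ring

end Combin
section Main

variable {K : Type*} [Field K] [CharZero K] {n : ℕ}

lemma fJ_insert {J : Finset (Fin n)} {j : Fin n} (hj : j ∉ J) :
    fJ K n (insert j J) = (X j * ∏ i ∈ Finset.univ.filter fun i => j < i, (X j - X i)) *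
      fJ K n J := by
  rw [fJ, Finset.prod_insert hj, fJ]

lemma rel_mem {J : Finset (Fin n)} {j : Fin n} (hj : j ∈ J) :
    lowProd (X : Fin n → MvPolynomial (Fin n) K) Jᶜ j ∈ colE (coinvIdeal K n) (fJ K n J) := by
  rw [mem_colE]
  refine Ideal.mem_of_dvd _ ?_ (full_mem_coinv K n j)
  have h1 : Finset.univ.erase j = (Jᶜ.filter (· < j) ∪ J.filter (· < j)) ∪
      Finset.univ.filter fun i => j < i := by
    ext k
    simp only [Finset.mem_erase, Finset.mem_univ, and_true, Finset.mem_union, Finset.mem_filter,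
      Finset.mem_compl, true_and, ← or_and_right, ne_iff_lt_or_gt]
    have : (k ∉ J ∨ k ∈ J) := by tauto
    tauto
  rw [h1, Finset.prod_union, Finset.prod_union]
  rotate_left
  · rw [Finset.disjoint_left]; intro a; simp; tauto
  · rw [Finset.disjoint_left]; intro a; simp only [Finset.mem_union, Finset.mem_filter]
    rintro (⟨_, h⟩ | ⟨_, h⟩) h2 <;> exact absurd h2.2 h.not_gt
  rw [fJ, ← Finset.mul_prod_erase J _ hj]
  have h2 : (∏ i ∈ J.filter (· < j), (X j - X i : MvPolynomial (Fin n) K)) ∣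
      ∏ k ∈ J.erase j, (X k * ∏ i ∈ Finset.univ.filter fun i => k < i, (X k - X i)) := by
    refine (Finset.prod_dvd_prod_of_dvd _
      (fun k => (X k * ∏ i ∈ Finset.univ.filter fun i => k < i, (X k - X i) :
        MvPolynomial (Fin n) K)) ?_).trans (Finset.prod_dvd_prod_of_subset _ _ _ ?_)
    · intro k hk
      have hkj : k < j := (Finset.mem_filter.1 hk).2
      refine Dvd.dvd.mul_left ?_ _
      refine Dvd.dvd.trans ?_ (Finset.dvd_prod_of_mem _ (show j ∈ _ by simpa using hkj))
      exact ⟨-1, by ring⟩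
    · intro k hk
      have := Finset.mem_filter.1 hk
      exact Finset.mem_erase.2 ⟨this.2.ne, this.1⟩
  obtain ⟨c, hc⟩ := h2
  rw [hc, lowProd]
  exact ⟨c, by ring⟩

lemma genBy_univ (Q : Ideal (MvPolynomial (Fin n) K)) :
    GenBy K (X : Fin n → MvPolynomial (Fin n) K) Finset.univ Q := by
  intro r
  refine ⟨r, ?_, by simp⟩
  simp [adjoin_range_X]

lemma spn_main (J : Finset (Fin n)) :
    SpnBy K (X : Fin n → MvPolynomial (Fin n) K) Finset.univ (stair J)
      (colE (coinvIdeal K n) (fJ K n J)) := by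
  have := classOne_all (K := K) (X : Fin n → MvPolynomial (Fin n) K) Finset.univ
    Jᶜ ∅ (fun _ => 1) (colE (coinvIdeal K n) (fJ K n J)) (by simp) (by simp) (by simp)
    (by simp) (fun k => le_colE (by simpa using psum_mem_coinv K n k))
    (fun j _ hj _ => rel_mem (by simpa using hj)) (by simp) (genBy_univ _)
  refine this.congr fun i _ => ?_
  rw [Finset.union_empty, hgt_stair]

/-- the linear factors of the row of `j` -/
def beta (K : Type*) [Field K] {n : ℕ} (j l : Fin n) : MvPolynomial (Fin n) K :=
  if l = j then X j else X j - X l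

lemma prod_beta (j : Fin n) :
    ∏ l ∈ Finset.univ.filter (fun l => j ≤ l), beta K j l =
      X j * ∏ i ∈ Finset.univ.filter fun i => j < i, (X j - X i) := by
  have : Finset.univ.filter (fun l => j ≤ l) =
      insert j (Finset.univ.filter fun i => j < i) := by
    ext k; simp [le_iff_eq_or_lt, eq_comm]
  rw [this, Finset.prod_insert (by simp)]
  congr 1
  · simp [beta]
  · refine Finset.prod_congr rfl fun i hi => ?_
    rw [beta, if_neg]
    rintro rfl
    simp at hi

lemma spn_beta {J : Finset (Fin n)} {j l : Fin n} (hJ : ∀ k ∈ J, k < j) (h : j ≤ l) :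
    SpnBy K (X : Fin n → MvPolynomial (Fin n) K) (Finset.univ.erase l) (stair (insert l J))
      (colE (coinvIdeal K n) (fJ K n J) ⊔ Ideal.span {beta K j l}) := by
  set Q := colE (coinvIdeal K n) (fJ K n J) ⊔ Ideal.span {beta K j l} with hQ
  have hl : l ∉ J := fun hh => absurd (hJ l hh) h.not_gt
  have hbQ : beta K j l ∈ Q := Ideal.mem_sup_right (Ideal.mem_span_singleton_self _)
  have hps : ∀ k, ∑ i, (X i : MvPolynomial (Fin n) K) ^ (k + 1) ∈ Q := fun k =>
    Ideal.mem_sup_left (le_colE (psum_mem_coinv K n k))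
  have hC : Jᶜ.erase l = (insert l J)ᶜ := by
    ext k; simp
  have := classOne_all (K := K) (X : Fin n → MvPolynomial (Fin n) K) (Finset.univ.erase l)
    (Jᶜ.erase l) ∅ (fun i => if i = j then 2 else 1) Q
    (Finset.erase_subset_erase _ (Finset.subset_univ _)) (by simp) (by simp)
    (fun i _ => by split_ifs <;> simp) ?_ ?_ (by simp) ?_
  · refine this.congr fun i _ => ?_
    rw [Finset.union_empty, hC, hgt_stair]
  · intro k
    have h1 := hps k
    rw [← Finset.add_sum_erase _ _ (Finset.mem_univ l)] at h1
    by_cases hlj : l = j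
    · subst hlj
      have h2 : (X l : MvPolynomial (Fin n) K) ^ (k + 1) ∈ Q := by
        have : (X l : MvPolynomial (Fin n) K) ∈ Q := by simpa [beta] using hbQ
        exact Ideal.pow_mem_of_mem _ this _ (Nat.succ_pos k)
      have h3 := (Ideal.add_mem_iff_right _ h2).1 h1
      convert h3 using 1
      refine Finset.sum_congr rfl fun i hi => ?_
      rw [if_neg (Finset.ne_of_mem_erase hi)]; simp
    · have h2 : (X j : MvPolynomial (Fin n) K) ^ (k + 1) - X l ^ (k + 1) ∈ Q := by
        rw [beta, if_neg hlj] at hbQ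
        exact Ideal.mem_of_dvd _ (sub_dvd_pow_sub_pow _ _ _) hbQ
      have h3 := Q.add_mem h1 h2
      have hjm : j ∈ Finset.univ.erase l := by simp [Ne.symm hlj]
      convert h3 using 1
      rw [← Finset.add_sum_erase _ _ hjm, ← Finset.add_sum_erase _ _ hjm, if_pos rfl]
      have : ∑ x ∈ (Finset.univ.erase l).erase j,
          (((if x = j then 2 else 1 : ℕ) : ℕ) : MvPolynomial (Fin n) K) * X x ^ (k + 1) =
          ∑ x ∈ (Finset.univ.erase l).erase j, X x ^ (k + 1) := by
        refine Finset.sum_congr rfl fun i hi => ?_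
        rw [if_neg (Finset.ne_of_mem_erase hi)]; simp
      rw [this]
      push_cast
      ring
  · intro i hi hi2 _
    have hil : i ≠ l := Finset.ne_of_mem_erase hi
    have hiJ : i ∈ J := by
      by_contra hh
      exact hi2 (by simp [hil, hh])
    have : lowProd (X : Fin n → MvPolynomial (Fin n) K) (Jᶜ.erase l) i = lowProd X Jᶜ i := by
      unfold lowProd
      congr 1
      ext k
      simp only [Finset.mem_filter, Finset.mem_erase]
      have : k < i → k ≠ l := fun hk => ((hk.trans (hJ i hiJ)).trans_le h).ne
      tauto
    rw [this]
    exact Ideal.mem_sup_left (rel_mem hiJ)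
  · refine (genBy_univ Q).mono' le_rfl fun i _ => ?_
    by_cases hil : i = l
    · subst hil
      by_cases hlj : i = j
      · exact ⟨0, zero_mem _, by simpa [beta, hlj] using hbQ⟩
      · refine ⟨X j, Algebra.subset_adjoin ⟨j, by simp [Ne.symm hlj], rfl⟩, ?_⟩
        rw [beta, if_neg hlj] at hbQ
        rw [← neg_sub]; exact neg_mem hbQ
    · exact ⟨X i, Algebra.subset_adjoin ⟨i, by simp [hil], rfl⟩, by simp⟩

lemma lower_bound (J : Finset (Fin n)) :
    ∏ i, stair J i ≤
      Module.finrank K (MvPolynomial (Fin n) K ⧸ colE (coinvIdeal K n) (fJ K n J)) := by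
  induction J using Finset.induction_on_max with
  | empty =>
    have h1 : colE (coinvIdeal K n) (fJ K n ∅) = coinvIdeal K n := by
      ext g; simp [mem_colE, fJ]
    have := (spn_main (K := K) (n := n) ∅).finrank_le.1
    rw [h1] at this ⊢
    have h2 : ∏ i : Fin n, stair ∅ i = n.factorial := by
      have : ∀ i : Fin n, stair ∅ i = (i : ℕ) + 1 := by
        intro i
        rw [← Fin.card_Iic, stair]; congr 1; ext k; simp
      simp only [this]
      rw [← Finset.prod_range (fun k => k + 1), Finset.prod_range_add_one_eq_factorial]
    rw [h2]
    exact factorial_le_finrank K n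
  | insert j J hJ ih =>
    have hj : j ∉ J := fun hh => absurd (hJ j hh) (lt_irrefl _)
    have := (spn_main (K := K) (n := n) J).finrank_le.1
    have h1 := finrank_colE_prod (K := K) (Finset.univ.filter (fun l => j ≤ l)) (beta K j)
      (colE (coinvIdeal K n) (fJ K n J)) (∏ k ∈ Finset.range (n - 1), stN J k) (by
        intro l hl
        have hl : j ≤ l := by simpa using hl
        rw [← prod_erase_stair hJ hl]
        exact (spn_beta hJ hl).finrank_le.2)
    have h2 : colE (colE (coinvIdeal K n) (fJ K n J))
        (∏ l ∈ Finset.univ.filter (fun l => j ≤ l), beta K j l) =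
        colE (coinvIdeal K n) (fJ K n (insert j J)) := by
      rw [prod_beta, fJ_insert hj]
      ext g; simp only [mem_colE, mul_assoc]
    have h3 : (Finset.univ.filter (fun l => j ≤ l)).card = n - j := by
      rw [← Fin.card_Ici]; congr 1; ext k; simp
    rw [h2, h3] at h1
    rw [prod_stair_step hJ] at ih
    omega

lemma final_aux (J : Finset (Fin n)) (Q : Ideal (MvPolynomial (Fin n) K))
    (hQ : Q = colE (coinvIdeal K n) (fJ K n J)) :
    LinearIndependent K
      (fun a : { a : Fin n → ℕ // ∀ i, a i < stair J i } =>
        Ideal.Quotient.mk Q (monomial (Finsupp.equivFunOnFinite.symm a.1) (1 : K))) ∧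
    Submodule.span K
      (Set.range (fun a : { a : Fin n → ℕ // ∀ i, a i < stair J i } =>
        Ideal.Quotient.mk Q (monomial (Finsupp.equivFunOnFinite.symm a.1) (1 : K)))) = ⊤ := by
  subst hQ
  set Q := colE (coinvIdeal K n) (fJ K n J)
  have hspan : Submodule.span K
      (Set.range (fun a : { a : Fin n → ℕ // ∀ i, a i < stair J i } =>
        Ideal.Quotient.mk Q (monomial (Finsupp.equivFunOnFinite.symm a.1) (1 : K)))) = ⊤ := by
    rw [eq_top_iff]
    rintro y -
    obtain ⟨r, rfl⟩ := Ideal.Quotient.mk_surjective y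
    obtain ⟨p, hp, hr⟩ := spn_main (K := K) J r
    rw [Ideal.Quotient.eq.2 hr]
    have : monsSp K (X : Fin n → MvPolynomial (Fin n) K) Finset.univ (stair J) ≤
        (Submodule.span K (Set.range (fun a : { a : Fin n → ℕ // ∀ i, a i < stair J i } =>
        Ideal.Quotient.mk Q (monomial (Finsupp.equivFunOnFinite.symm a.1) (1 : K))))).comap
        (Ideal.Quotient.mkₐ K Q).toLinearMap := by
      refine Submodule.span_le.2 ?_
      rintro y ⟨a, ha, rfl⟩
      refine Submodule.subset_span ⟨⟨a, fun i => ha i (Finset.mem_univ i)⟩, ?_⟩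
      simp only [AlgHom.toLinearMap_apply, Ideal.Quotient.mkₐ_eq_mk]
      congr 1
      rw [monomial_eq, C_1, one_mul, Finsupp.prod_fintype _ _ (by simp)]
      simp
    exact this hp
  refine ⟨?_, hspan⟩
  let e : { a : Fin n → ℕ // ∀ i, a i < stair J i } ≃ ((i : Fin n) → Fin (stair J i)) :=
    { toFun := fun a i => ⟨a.1 i, a.2 i⟩
      invFun := fun b => ⟨fun i => b i, fun i => (b i).2⟩
      left_inv := fun a => rfl
      right_inv := fun b => rfl }
  let : Fintype { a : Fin n → ℕ // ∀ i, a i < stair J i } := Fintype.ofEquiv _ e.symm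
  have hcard : Fintype.card { a : Fin n → ℕ // ∀ i, a i < stair J i } = ∏ i, stair J i := by
    rw [Fintype.card_congr e]; simp
  rw [linearIndependent_iff_card_le_finrank_span, Set.finrank, hspan, finrank_top, hcard]
  exact lower_bound J

end Main

theorem statement0 (K : Type*) [Field K] [CharZero K] (n : ℕ) (hn : 0 < n)
    (J : Finset (Fin n)) :
    LinearIndependent K
      (fun a : { a : Fin n → ℕ // ∀ i, a i < stair J i } =>
        Ideal.Quotient.mk ((coinvIdeal K n).colon (Ideal.span {fJ K n J}))
          (monomial (Finsupp.equivFunOnFinite.symm a.1) (1 : K))) ∧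
    Submodule.span K
      (Set.range (fun a : { a : Fin n → ℕ // ∀ i, a i < stair J i } =>
        Ideal.Quotient.mk ((coinvIdeal K n).colon (Ideal.span {fJ K n J}))
          (monomial (Finsupp.equivFunOnFinite.symm a.1) (1 : K)))) = ⊤ := by

  refine final_aux J _ ?_
  ext g
  rw [mem_colE, Ideal.mem_colon_span_singleton]
end
end

section
/- The set M of superspace Artin monomials descends to a K-vector space basis of the superspace coinvariant ring SR = Ω/I. -/
open MvPolynomial TensorProduct

noncomputable section

/-- The superspace ring `Ω = K[x_1,…,x_n] ⊗ Λ(θ_1,…,θ_n)`. -/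
abbrev SuperRing (K : Type*) [Field K] (n : ℕ) : Type _ :=
  MvPolynomial (Fin n) K ⊗[K] ExteriorAlgebra K (Fin n → K)

/-- The diagonal action of a permutation `w` on the superspace ring:
`x_i ↦ x_{w(i)}` and `θ_i ↦ θ_{w(i)}`. -/
def permAct (K : Type*) [Field K] (n : ℕ) (w : Equiv.Perm (Fin n)) :
    SuperRing K n →ₐ[K] SuperRing K n :=
  Algebra.TensorProduct.map (rename w)
    (ExteriorAlgebra.map (LinearMap.funLeft K K ⇑w⁻¹))

/-- The augmentation (constant term) map `Ω → K`. -/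
def superAug (K : Type*) [Field K] (n : ℕ) : SuperRing K n →ₐ[K] K :=
  Algebra.TensorProduct.lift (aeval 0) ExteriorAlgebra.algebraMapInv
    (fun _ _ => Commute.all _ _)

/-- The set of `S_n`-invariant elements of the superspace ring with vanishing
constant term. -/
def superInv0 (K : Type*) [Field K] (n : ℕ) : Set (SuperRing K n) :=
  {g | (∀ w : Equiv.Perm (Fin n), permAct K n w g = g) ∧ superAug K n g = 0}

/-- The two-sided ideal of `Ω` generated by the invariants with vanishing constant
term, as a `K`-submodule (a two-sided ideal is exactly the `K`-span of the products
`x · g · y` with `g` a generator). -/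
def superIdeal (K : Type*) [Field K] (n : ℕ) : Submodule K (SuperRing K n) :=
  Submodule.span K
    {z | ∃ x g y : SuperRing K n, g ∈ superInv0 K n ∧ z = x * g * y}

/-- The product `θ_J` of the `θ_j`, `j ∈ J`, in increasing order of subscript. -/
def thetaMon (K : Type*) [Field K] (n : ℕ) (J : Finset (Fin n)) :
    ExteriorAlgebra K (Fin n → K) :=
  ((J.sort (· ≤ ·)).map fun j => ExteriorAlgebra.ι K (Pi.single j (1 : K))).prod

namespace SArt

/-- column heights -/
def hgt {ι : Type*} [LinearOrder ι] (J A Z : Finset ι) (i : ι) : ℕ :=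
  (A.filter fun l => l < i ∧ l ∉ J).card + if i ∈ Z then 1 else 0

def monSet {ι S : Type*} [LinearOrder ι] [CommRing S] (x : ι → S) (J A Z : Finset ι) : Set S :=
  {m | ∃ a : ι → ℕ, (∀ i ∈ A, a i < hgt J A Z i) ∧ m = ∏ i ∈ A, x i ^ a i}

lemma poly_dvd_aux {S : Type*} [CommRing S] {𝔟 : Ideal S} {a b : S} (h : a ∣ b) (ha : a ∈ 𝔟) :
    b ∈ 𝔟 := 𝔟.mem_of_dvd h ha

def colonI {S : Type*} [CommRing S] (𝔟 : Ideal S) (y : S) : Ideal S where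
  carrier := {p | y * p ∈ 𝔟}
  add_mem' := by
    intro a b ha hb
    simp only [Set.mem_ofPred_eq] at *
    rw [mul_add]; exact 𝔟.add_mem ha hb
  zero_mem' := by simp
  smul_mem' := by
    intro c p hp
    simp only [Set.mem_ofPred_eq, smul_eq_mul] at *
    rw [mul_left_comm]; exact 𝔟.mul_mem_left _ hp

lemma mem_colonI {S : Type*} [CommRing S] (𝔟 : Ideal S) (y p : S) :
    p ∈ colonI 𝔟 y ↔ y * p ∈ 𝔟 := Iff.rfl

lemma le_colonI {S : Type*} [CommRing S] (𝔟 : Ideal S) (y : S) : 𝔟 ≤ colonI 𝔟 y :=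
  fun _ hp => 𝔟.mul_mem_left _ hp

structure Hyp {ι S K : Type*} [LinearOrder ι] [Field K] [CommRing S] [Algebra K S]
    (x : ι → S) (c : ι → K) (J A Z : Finset ι) (𝔟 : Ideal S) : Prop where
  sub : Z ⊆ A
  low : ∀ i ∈ Z, ∀ l ∈ A, l < i → l ∈ Z
  wt : ∀ B ⊆ A, B.Nonempty → ∑ i ∈ B, c i ≠ 0
  h0 : ∀ p : S, ∃ r : K, p - algebraMap K S r ∈ 𝔟 ⊔ Ideal.span (x '' A)
  ha : ∀ i ∈ A, i ∈ J → (if i ∈ Z then x i else 1) *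
    ∏ l ∈ A.filter (fun l => l < i ∧ l ∉ J), (x i - x l) ∈ 𝔟
  b1 : ∀ q : Polynomial S, ∑ l ∈ A, c l • (x l * q.eval (x l)) ∈ 𝔟
  b2 : ∀ q : Polynomial S, ∑ l ∈ A \ Z, c l • ((∏ i ∈ Z \ J, (x l - x i)) * q.eval (x l)) ∈ 𝔟

section
variable {ι S K : Type*} [LinearOrder ι] [Field K] [CommRing S] [Algebra K S]
    {x : ι → S} {c : ι → K} {J A Z : Finset ι} {𝔟 : Ideal S}

lemma smul_mem_I (r : K) {p : S} (hp : p ∈ 𝔟) : r • p ∈ 𝔟 := by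
  rw [Algebra.smul_def]; exact 𝔟.mul_mem_left _ hp

lemma Hyp.colon (h : Hyp x c J A Z 𝔟) {k : ι} (hk : k ∈ Z) (hmax : ∀ i ∈ Z, i ≤ k) :
    Hyp x c J A (Z.erase k) (colonI 𝔟 (x k)) where
  sub := (Finset.erase_subset _ _).trans h.sub
  low := by
    intro i hi l hl hli
    rw [Finset.mem_erase] at hi ⊢
    refine ⟨?_, h.low i hi.2 l hl hli⟩
    rintro rfl
    exact absurd (hmax i hi.2) (not_le.2 hli)
  wt := h.wt
  h0 := by
    intro p
    obtain ⟨r, hr⟩ := h.h0 p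
    exact ⟨r, (sup_le_sup_right (le_colonI 𝔟 (x k)) (Ideal.span (x '' A))) hr⟩
  ha := by
    intro i hi hiJ
    have := h.ha i hi hiJ
    by_cases hik : i = k
    · subst hik
      rw [mem_colonI]
      simpa [hk] using this
    · apply le_colonI
      simpa [Finset.mem_erase, hik] using this
  b1 := fun q => le_colonI _ _ (h.b1 q)
  b2 := by
    intro q
    rw [mem_colonI]
    have hkA := h.sub hk
    have e1 : A \ Z.erase k = insert k (A \ Z) := by
      ext l; simp only [Finset.mem_sdiff, Finset.mem_erase, Finset.mem_insert]
      by_cases hl : l = k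
      · subst hl; simp [hkA]
      · simp [hl]
    have hkn : k ∉ A \ Z := by simp [hk]
    by_cases hkJ : k ∈ J
    · have e2 : Z.erase k \ J = Z \ J := by
        ext l; simp only [Finset.mem_sdiff, Finset.mem_erase]
        constructor
        · tauto
        · rintro ⟨h1, h2⟩; refine ⟨⟨?_, h1⟩, h2⟩; rintro rfl; exact h2 hkJ
      rw [e1, Finset.sum_insert hkn, e2, mul_add]
      refine 𝔟.add_mem ?_ (𝔟.mul_mem_left _ (h.b2 q))
      have := h.ha k hkA hkJ
      rw [if_pos hk] at this
      have e3 : Z \ J = A.filter (fun l => l < k ∧ l ∉ J) := by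
        ext l; simp only [Finset.mem_sdiff, Finset.mem_filter]
        constructor
        · rintro ⟨h1, h2⟩
          exact ⟨h.sub h1, lt_of_le_of_ne (hmax l h1) (by rintro rfl; exact h2 hkJ), h2⟩
        · rintro ⟨h1, h2, h3⟩
          exact ⟨h.low k hk l h1 h2, h3⟩
      rw [e3, mul_smul_comm, ← mul_assoc]
      exact smul_mem_I _ (𝔟.mul_mem_right _ this)
    · have hkZJ : k ∈ Z \ J := by simp [hk, hkJ]
      have e2 : Z.erase k \ J = (Z \ J).erase k := by
        ext l; simp only [Finset.mem_sdiff, Finset.mem_erase]; tauto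
      set P : S → S := fun y => ∏ i ∈ (Z \ J).erase k, (y - x i) with hP
      have hPk : ∀ y, ∏ i ∈ Z \ J, (y - x i) = (y - x k) * P y := fun y =>
        (Finset.mul_prod_erase _ _ hkZJ).symm
      have hb2 := h.b2 q
      simp only [hPk] at hb2
      have hb1 := h.b1 ((∏ i ∈ (Z \ J).erase k, (Polynomial.X - Polynomial.C (x i))) * q)
      have hPe : ∀ y, Polynomial.eval y ((∏ i ∈ (Z \ J).erase k, (Polynomial.X - Polynomial.C (x i))) * q)
          = P y * q.eval y := by
        intro y; simp [Polynomial.eval_prod, hP]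
      simp only [hPe] at hb1
      rw [e2]
      show x k * ∑ l ∈ A \ Z.erase k, c l • (P (x l) * _) ∈ 𝔟
      have hlow : ∑ l ∈ Z.erase k, c l • (x l * (P (x l) * q.eval (x l))) ∈ 𝔟 := by
        refine 𝔟.sum_mem fun l hl => smul_mem_I _ ?_
        rw [Finset.mem_erase] at hl
        have hlk : l < k := lt_of_le_of_ne (hmax l hl.2) hl.1
        rw [← mul_assoc]
        refine 𝔟.mul_mem_right _ ?_
        by_cases hlJ : l ∈ J
        · have := h.ha l (h.sub hl.2) hlJ
          rw [if_pos hl.2] at this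
          refine poly_dvd_aux (mul_dvd_mul_left _ ?_) this
          refine Finset.prod_dvd_prod_of_subset _ _ _ ?_
          intro j hj
          simp only [Finset.mem_filter, Finset.mem_erase, Finset.mem_sdiff] at hj ⊢
          exact ⟨(hj.2.1.trans hlk).ne, h.low l hl.2 j hj.1 hj.2.1, hj.2.2⟩
        · have : P (x l) = 0 := by
            apply Finset.prod_eq_zero (i := l)
            · simp [hl.1, hl.2, hlJ]
            · simp
          rw [this]; simp
      have e4 : ∑ l ∈ A \ Z.erase k, c l • (x l * (P (x l) * q.eval (x l)))
         + ∑ l ∈ Z.erase k, c l • (x l * (P (x l) * q.eval (x l))) =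
         ∑ l ∈ A, c l • (x l * (P (x l) * q.eval (x l))) :=
        Finset.sum_sdiff ((Finset.erase_subset _ _).trans h.sub)
      have e5 : x k * ∑ l ∈ A \ Z.erase k, c l • (P (x l) * q.eval (x l)) =
          ∑ l ∈ A, c l • (x l * (P (x l) * q.eval (x l)))
          - ∑ l ∈ Z.erase k, c l • (x l * (P (x l) * q.eval (x l)))
          - ∑ l ∈ A \ Z, c l • ((x l - x k) * P (x l) * q.eval (x l)) := by
        rw [← e4, add_sub_cancel_right, e1, Finset.sum_insert hkn, Finset.sum_insert hkn, mul_add,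
          add_sub_assoc, ← Finset.sum_sub_distrib, mul_smul_comm, Finset.mul_sum]
        congr 1
        refine Finset.sum_congr rfl fun l _ => ?_
        rw [mul_smul_comm, ← smul_sub]
        congr 1; ring
      rw [e5]
      exact 𝔟.sub_mem (𝔟.sub_mem hb1 hlow) hb2

lemma Hyp.contract (h : Hyp x c J A Z 𝔟) {k : ι} (hk : k ∈ Z) (hmax : ∀ i ∈ Z, i ≤ k) :
    Hyp x c J (A.erase k) (if k ∈ J then Z.erase k else A.erase k) (𝔟 ⊔ Ideal.span {x k}) := by
  have hkA := h.sub hk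
  have hxk : x k ∈ 𝔟 ⊔ Ideal.span {x k} := Ideal.mem_sup_right (Ideal.subset_span rfl)
  have hle : 𝔟 ≤ 𝔟 ⊔ Ideal.span {x k} := le_sup_left
  refine ⟨?_, ?_, ?_, ?_, ?_, ?_, ?_⟩
  · split_ifs
    · exact Finset.erase_subset_erase _ h.sub
    · exact subset_rfl
  · intro i hi l hl hli
    split_ifs at hi ⊢ with hkJ
    · rw [Finset.mem_erase] at hi hl ⊢
      exact ⟨hl.1, h.low i hi.2 l hl.2 hli⟩
    · exact hl
  · intro B hB; exact h.wt B (hB.trans (Finset.erase_subset _ _))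
  · intro p
    obtain ⟨r, hr⟩ := h.h0 p
    refine ⟨r, ?_⟩
    revert hr
    apply fun (hh : 𝔟 ⊔ Ideal.span (x '' A) ≤ _) hr => hh hr
    refine sup_le (hle.trans le_sup_left) ?_
    rw [Ideal.span_le]
    rintro _ ⟨i, hi, rfl⟩
    by_cases hik : i = k
    · subst hik; exact Ideal.mem_sup_left hxk
    · exact Ideal.mem_sup_right (Ideal.subset_span ⟨i, by simpa [hik] using hi, rfl⟩)
  · intro i hi hiJ
    rw [Finset.mem_erase] at hi
    have := hle (h.ha i hi.2 hiJ)
    by_cases hkJ : k ∈ J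
    · have e : (A.erase k).filter (fun l => l < i ∧ l ∉ J) = A.filter (fun l => l < i ∧ l ∉ J) := by
        ext l; simp only [Finset.mem_filter, Finset.mem_erase]
        constructor
        · tauto
        · rintro ⟨h1, h2, h3⟩; exact ⟨⟨by rintro rfl; exact h3 hkJ, h1⟩, h2, h3⟩
      rw [e]
      simpa [hkJ, Finset.mem_erase, hi.1] using this
    · simp only [hkJ, if_false, Finset.mem_erase, hi.1, hi.2, ne_eq, not_false_eq_true, and_self, if_true]
      by_cases hik : i < k
      · have e : (A.erase k).filter (fun l => l < i ∧ l ∉ J) = A.filter (fun l => l < i ∧ l ∉ J) := by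
          ext l; simp only [Finset.mem_filter, Finset.mem_erase]
          constructor
          · tauto
          · rintro ⟨h1, h2, h3⟩; exact ⟨⟨(h2.trans hik).ne, h1⟩, h2, h3⟩
        rw [e]
        rwa [if_pos (h.low k hk i hi.2 hik)] at this
      · have hki : k < i := lt_of_le_of_ne (not_lt.1 hik) (Ne.symm hi.1)
        have hiZ : i ∉ Z := fun hh => absurd (hmax i hh) (not_le.2 hki)
        have e : (A.erase k).filter (fun l => l < i ∧ l ∉ J) =
            (A.filter (fun l => l < i ∧ l ∉ J)).erase k := by
          ext l; simp only [Finset.mem_filter, Finset.mem_erase]; tauto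
        rw [if_neg hiZ, one_mul, ← Finset.mul_prod_erase (a := k)] at this
        · rw [e]
          have e2 : ∀ P : S, x i * P = (x i - x k) * P + x k * P := by intro P; ring
          rw [e2]
          exact Ideal.add_mem _ this (Ideal.mul_mem_right _ _ hxk)
        · simp [hkA, hki, hkJ]
  · intro q
    have := hle (h.b1 q)
    rw [← Finset.add_sum_erase _ _ hkA] at this
    rwa [Ideal.add_mem_iff_right] at this
    exact smul_mem_I _ (Ideal.mul_mem_right _ _ hxk)
  · intro q
    split_ifs with hkJ
    · have e2 : Z.erase k \ J = Z \ J := by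
        ext l; simp only [Finset.mem_sdiff, Finset.mem_erase]
        constructor
        · tauto
        · rintro ⟨h1, h2⟩; refine ⟨⟨?_, h1⟩, h2⟩; rintro rfl; exact h2 hkJ
      have e3 : A.erase k \ Z.erase k = A \ Z := by
        ext l; simp only [Finset.mem_sdiff, Finset.mem_erase]
        by_cases hl : l = k
        · subst hl; simp [hk]
        · simp [hl]
      rw [e2, e3]
      exact hle (h.b2 q)
    · simp

theorem spanning (h : Hyp x c J A Z 𝔟) (p : S) :
    ∃ w ∈ Submodule.span K (monSet x J A Z), p - w ∈ 𝔟 := by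
  induction hN : A.card * A.card + Z.card using Nat.strong_induction_on generalizing A Z 𝔟 p with
  | _ N ih =>
  by_cases hZ : Z.Nonempty
  · set k := Z.max' hZ with hkdef
    have hk : k ∈ Z := Z.max'_mem hZ
    have hmax : ∀ i ∈ Z, i ≤ k := fun i hi => Z.le_max' i hi
    have hkA := h.sub hk
    have hcol := h.colon hk hmax
    have hcon := h.contract hk hmax
    have c1 : (Z.erase k).card + 1 = Z.card := Finset.card_erase_add_one hk
    have c2 : (A.erase k).card + 1 = A.card := Finset.card_erase_add_one hkA
    obtain ⟨w2, hw2, hp2⟩ := ih _ (by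
      have : (A.erase k).card * (A.erase k).card +
          (if k ∈ J then Z.erase k else A.erase k).card < N := by
        rw [← hN, ← c2, ← c1]
        split_ifs <;> nlinarith
      exact this) hcon p rfl
    obtain ⟨b, hb, y, hy, hby⟩ := Submodule.mem_sup.1 hp2
    obtain ⟨q, rfl⟩ := Ideal.mem_span_singleton'.1 hy
    obtain ⟨w1, hw1, hq⟩ := ih _ (by omega) hcol q rfl
    refine ⟨w2 + x k * w1, ?_, ?_⟩
    · refine Submodule.add_mem _ ?_ ?_
      · refine Submodule.span_mono ?_ hw2
        rintro _ ⟨a, ha, rfl⟩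
        refine ⟨Function.update a k 0, ?_, ?_⟩
        · intro i hi
          by_cases hik : i = k
          · subst hik; simp [hgt, hk]
          · rw [Function.update_of_ne hik]
            refine (ha i (by simp [hik, hi])).trans_le ?_
            unfold hgt
            by_cases hkJ : k ∈ J
            · rw [if_pos hkJ]
              refine add_le_add (Finset.card_le_card
                (Finset.filter_subset_filter _ (Finset.erase_subset _ _))) ?_
              simp [Finset.mem_erase, hik]
            · rw [if_neg hkJ, if_pos (by simp [hik, hi])]
              by_cases hlt : i < k
              · rw [if_pos (h.low k hk i hi hlt)]
                exact add_le_add (Finset.card_le_card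
                  (Finset.filter_subset_filter _ (Finset.erase_subset _ _))) le_rfl
              · have hki : k < i := lt_of_le_of_ne (not_lt.1 hlt) (Ne.symm hik)
                have e : (A.erase k).filter (fun l => l < i ∧ l ∉ J) =
                    (A.filter (fun l => l < i ∧ l ∉ J)).erase k := by
                  ext l; simp only [Finset.mem_filter, Finset.mem_erase]; tauto
                rw [e, Finset.card_erase_add_one (by simp [hkA, hki, hkJ])]
                omega
        · rw [← Finset.mul_prod_erase _ _ hkA]
          simp only [Function.update_self, pow_zero, one_mul]
          refine Finset.prod_congr rfl fun i hi => ?_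
          rw [Function.update_of_ne (Finset.ne_of_mem_erase hi)]
      · have : Submodule.span K (monSet x J A (Z.erase k)) ≤
            (Submodule.span K (monSet x J A Z)).comap (LinearMap.mulLeft K (x k)) := by
          rw [Submodule.span_le]
          rintro _ ⟨a, ha, rfl⟩
          refine Submodule.subset_span ⟨Function.update a k (a k + 1), ?_, ?_⟩
          · intro i hi
            have h1 := ha i hi
            by_cases hik : i = k
            · subst hik
              rw [Function.update_self]
              simp only [hgt, Finset.mem_erase, ne_eq, not_true_eq_false, false_and, if_false, hk, if_true] at h1 ⊢
              omega
            · rw [Function.update_of_ne hik]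
              simpa [hgt, Finset.mem_erase, hik] using h1
          · rw [LinearMap.mulLeft_apply, ← Finset.mul_prod_erase _ _ hkA, ← Finset.mul_prod_erase _ _ hkA,
              Function.update_self, ← mul_assoc, ← pow_succ']
            congr 1
            refine Finset.prod_congr rfl fun i hi => ?_
            rw [Function.update_of_ne (Finset.ne_of_mem_erase hi)]
        exact this hw1
    · rw [mem_colonI] at hq
      have : p - (w2 + x k * w1) = b + x k * (q - w1) := by
        have : p = b + q * x k + w2 := by rw [hby]; ring
        rw [this]; ring
      rw [this]
      exact 𝔟.add_mem hb hq
  · rw [Finset.not_nonempty_iff_eq_empty] at hZ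
    subst hZ
    by_cases hA : A.Nonempty
    · have := h.b2 1
      simp only [Finset.sdiff_empty, Finset.empty_sdiff, Finset.prod_empty, Polynomial.eval_one, mul_one,
        ← Finset.sum_smul] at this
      have h1 := smul_mem_I (∑ i ∈ A, c i)⁻¹ this
      rw [smul_smul, inv_mul_cancel₀ (h.wt A subset_rfl hA), one_smul] at h1
      rw [(Ideal.eq_top_iff_one _).2 h1]
      exact ⟨0, Submodule.zero_mem _, trivial⟩
    · rw [Finset.not_nonempty_iff_eq_empty] at hA
      subst hA
      obtain ⟨r, hr⟩ := h.h0 p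
      simp only [Finset.coe_empty, Set.image_empty, Ideal.span_empty, sup_bot_eq] at hr
      refine ⟨algebraMap K S r, ?_, hr⟩
      rw [Algebra.algebraMap_eq_smul_one]
      exact Submodule.smul_mem _ _ (Submodule.subset_span ⟨0, by simp, by simp⟩)
end
end SArt

namespace SArt
section
variable {K : Type*} [Field K]

def pIdeal (K : Type*) [Field K] (n : ℕ) : Ideal (MvPolynomial (Fin n) K) :=
  Ideal.span (Set.range fun r : ℕ => ∑ i : Fin n, (X i : MvPolynomial (Fin n) K) ^ (r + 1))

lemma sum_eval_mem {n : ℕ} (q : Polynomial (MvPolynomial (Fin n) K)) :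
    ∑ l : Fin n, X l * q.eval (X l) ∈ pIdeal K n := by
  induction q using Polynomial.induction_on' with
  | add p q hp hq =>
    simp only [Polynomial.eval_add, mul_add, Finset.sum_add_distrib]
    exact Ideal.add_mem _ hp hq
  | monomial r a =>
    have : ∑ l : Fin n, (X l : MvPolynomial (Fin n) K) * (Polynomial.monomial r a).eval (X l) =
        a * ∑ l : Fin n, X l ^ (r + 1) := by
      rw [Finset.mul_sum]
      refine Finset.sum_congr rfl fun l _ => ?_
      rw [Polynomial.eval_monomial]; ring
    rw [this]
    exact Ideal.mul_mem_left _ _ (Ideal.subset_span ⟨r, rfl⟩)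

def Cov {S : Type*} (K : Type*) [Field K] [CommRing S] [Algebra K S] (𝔟 : Ideal S) (d : ℕ) : Prop :=
  ∃ B : Finset S, B.card ≤ d ∧ ∀ p : S, ∃ w ∈ Submodule.span K (B : Set S), p - w ∈ 𝔟

lemma Cov.mono {S : Type*} [CommRing S] [Algebra K S] {𝔟 : Ideal S} {d e : ℕ} (h : Cov K 𝔟 d)
    (hde : d ≤ e) : Cov K 𝔟 e := by
  obtain ⟨B, hB, h⟩ := h
  exact ⟨B, hB.trans hde, h⟩

lemma cov_of_hyp {ι S : Type*} [LinearOrder ι] [CommRing S] [Algebra K S]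
    {x : ι → S} {c : ι → K} {J A Z : Finset ι} {𝔟 : Ideal S} (h : Hyp x c J A Z 𝔟) :
    Cov K 𝔟 (∏ i ∈ A, hgt J A Z i) := by
  classical
  refine ⟨(A.pi fun i => Finset.range (hgt J A Z i)).image
    (fun f => ∏ i ∈ A.attach, x i ^ f i.1 i.2), ?_, ?_⟩
  · refine Finset.card_image_le.trans ?_
    simp [Finset.card_pi]
  · intro p
    obtain ⟨w, hw, hp⟩ := spanning h p
    refine ⟨w, Submodule.span_mono ?_ hw, hp⟩
    rintro _ ⟨a, ha, rfl⟩
    rw [Finset.mem_coe, Finset.mem_image]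
    refine ⟨fun i _ => a i, ?_, ?_⟩
    · simpa [Finset.mem_pi] using ha
    · exact Finset.prod_attach A (fun i => x i ^ a i)

lemma cov_chain {S : Type*} [CommRing S] [Algebra K S] {𝔟 : Ideal S} {y : S} {d e : ℕ}
    (h1 : Cov K (colonI 𝔟 y) d) (h2 : Cov K (𝔟 ⊔ Ideal.span {y}) e) : Cov K 𝔟 (d + e) := by
  classical
  obtain ⟨B, hB, h1⟩ := h1
  obtain ⟨C, hC, h2⟩ := h2
  refine ⟨B.image (y * ·) ∪ C, (Finset.card_union_le _ _).trans
    (add_le_add (Finset.card_image_le.trans hB) hC), fun p => ?_⟩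
  obtain ⟨w2, hw2, hp⟩ := h2 p
  obtain ⟨b, hb, z, hz, hbz⟩ := Submodule.mem_sup.1 hp
  obtain ⟨q, rfl⟩ := Ideal.mem_span_singleton'.1 hz
  obtain ⟨w1, hw1, hq⟩ := h1 q
  refine ⟨w2 + y * w1, Submodule.add_mem _ (Submodule.span_mono (by simp) hw2) ?_, ?_⟩
  · have : Submodule.span K (B : Set S) ≤ (Submodule.span K
        ((B.image (y * ·) ∪ C : Finset S) : Set S)).comap (LinearMap.mulLeft K y) := by
      rw [Submodule.span_le]
      intro b hb
      refine Submodule.subset_span ?_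
      simp only [Finset.coe_union, Finset.coe_image]
      exact Or.inl ⟨b, hb, rfl⟩
    exact this hw1
  · rw [mem_colonI] at hq
    have : p - (w2 + y * w1) = b + y * (q - w1) := by
      have : p = b + q * y + w2 := by rw [hbz]; ring
      rw [this]; ring
    rw [this]
    exact 𝔟.add_mem hb hq

def gJ (K : Type*) [Field K] {n : ℕ} (J : Finset (Fin n)) : MvPolynomial (Fin n) K :=
  ∏ j ∈ J, ∏ i ∈ Finset.Ioi j, (X j - X i)

lemma prod_ne_mem {n : ℕ} (i : Fin n) :
    (X i : MvPolynomial (Fin n) K) * ∏ l ∈ Finset.univ.erase i, (X i - X l) ∈ pIdeal K n := by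
  have := sum_eval_mem (K := K) (∏ l ∈ Finset.univ.erase i, (Polynomial.X - Polynomial.C (X l)))
  rw [← Finset.add_sum_erase _ _ (Finset.mem_univ i), Finset.sum_eq_zero, add_zero] at this
  · simpa [Polynomial.eval_prod] using this
  · intro l hl
    rw [Polynomial.eval_prod, Finset.prod_eq_zero hl (by simp), mul_zero]

lemma gJ_mem {n : ℕ} (J : Finset (Fin n)) {i : Fin n} (hi : i ∈ J) :
    gJ K J * (X i * ∏ l ∈ Finset.univ.filter (fun l => l < i ∧ l ∉ J), (X i - X l)) ∈ pIdeal K n := by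
  refine poly_dvd_aux ?_ (prod_ne_mem i)
  have e : (Finset.univ.erase i : Finset (Fin n)) =
      (Finset.Ioi i ∪ J.filter (· < i)) ∪ Finset.univ.filter (fun l => l < i ∧ l ∉ J) := by
    ext l
    simp only [Finset.mem_erase, Finset.mem_univ, Finset.mem_union, Finset.mem_Ioi, Finset.mem_filter]
    rcases lt_trichotomy l i with h | h | h
    · simp [h, h.ne]; tauto
    · simp [h]
    · simp [h, h.ne']
  rw [mul_left_comm]
  refine mul_dvd_mul_left _ ?_
  rw [e, Finset.prod_union, Finset.prod_union]
  · refine mul_dvd_mul_right ?_ _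
    rw [gJ, ← Finset.mul_prod_erase _ _ hi]
    refine mul_dvd_mul_left _ ?_
    refine dvd_trans ?_ (Finset.prod_dvd_prod_of_subset (J.filter (· < i)) (J.erase i) _ ?_)
    · refine Finset.prod_dvd_prod_of_dvd _ _ fun j hj => ?_
      rw [Finset.mem_filter] at hj
      rw [← neg_dvd, neg_sub]
      exact Finset.dvd_prod_of_mem (fun m => (X j - X m : MvPolynomial (Fin n) K)) (by simpa using hj.2)
    · intro j hj
      simp only [Finset.mem_filter, Finset.mem_erase] at hj ⊢
      exact ⟨hj.2.ne, hj.1⟩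
  · rw [Finset.disjoint_left]; intro l h1 h2
    simp only [Finset.mem_Ioi, Finset.mem_filter] at h1 h2
    exact absurd h2.2 (not_lt.2 h1.le)
  · rw [Finset.disjoint_left]; intro l h1 h2
    simp only [Finset.mem_union, Finset.mem_Ioi, Finset.mem_filter] at h1 h2
    rcases h1 with h1 | h1
    · exact absurd h2.2.1 (not_lt.2 h1.le)
    · exact h2.2.2 h1.1

lemma sub_const_mem {σ : Type*} (I : Ideal (MvPolynomial σ K)) (hI : ∀ i, X i ∈ I)
    (p : MvPolynomial σ K) : ∃ r : K, p - algebraMap K _ r ∈ I := by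
  induction p using MvPolynomial.induction_on with
  | C a => exact ⟨a, by simp [MvPolynomial.algebraMap_eq]⟩
  | add p q hp hq =>
    obtain ⟨a, ha⟩ := hp
    obtain ⟨b, hb⟩ := hq
    refine ⟨a + b, ?_⟩
    have : p + q - algebraMap K _ (a + b) = (p - algebraMap K _ a) + (q - algebraMap K _ b) := by
      rw [map_add]; ring
    rw [this]; exact I.add_mem ha hb
  | mul_X p i hp => exact ⟨0, by simpa using I.mul_mem_left _ (hI i)⟩

lemma hyp_contract [CharZero K] {n : ℕ} (J : Finset (Fin n)) (s k : Fin n) (hJ : ∀ j ∈ J, j < s) (hk : s < k)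
    (𝔠 : Ideal (MvPolynomial (Fin n) K)) (hP : pIdeal K n ≤ 𝔠)
    (hc : ∀ i ∈ J, X i * ∏ l ∈ Finset.univ.filter (fun l => l < i ∧ l ∉ J), (X i - X l) ∈ 𝔠) :
    Hyp (fun i => (X i : MvPolynomial (Fin n) K)) (fun i => (((if i = s then 2 else 1 : ℕ)) : K)) J
      (Finset.univ.erase k) (Finset.univ.erase k) (𝔠 ⊔ Ideal.span {X s - X k}) := by
  have hle : 𝔠 ≤ 𝔠 ⊔ Ideal.span {X s - X k} := le_sup_left
  have hsk : (X s - X k : MvPolynomial (Fin n) K) ∈ 𝔠 ⊔ Ideal.span {X s - X k} :=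
    Ideal.mem_sup_right (Ideal.subset_span rfl)
  refine ⟨subset_rfl, fun _ _ l hl _ => hl, ?_, ?_, ?_, ?_, ?_⟩
  · intro B _ hB
    rw [← Nat.cast_sum, Nat.cast_ne_zero]
    apply ne_of_gt
    apply Finset.sum_pos _ hB
    intro i _
    split_ifs <;> simp
  · apply sub_const_mem
    intro i
    have key : ∀ j, j ≠ k → (X j : MvPolynomial (Fin n) K) ∈ (𝔠 ⊔ Ideal.span {X s - X k}) ⊔
        Ideal.span ((fun i => (X i : MvPolynomial (Fin n) K)) '' (Finset.univ.erase k : Finset (Fin n))) := by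
      intro j hj
      exact Ideal.mem_sup_right (Ideal.subset_span ⟨j, by simpa using hj, rfl⟩)
    by_cases hik : i = k
    · subst hik
      have h5 := Ideal.sub_mem _ (key s hk.ne) (Ideal.mem_sup_left hsk)
      rwa [sub_sub_cancel] at h5
    · exact key i hik
  · intro i hi hiJ
    rw [if_pos hi]
    have e : (Finset.univ.erase k).filter (fun l => l < i ∧ l ∉ J) =
        Finset.univ.filter (fun l => l < i ∧ l ∉ J) := by
      ext l
      simp only [Finset.mem_filter, Finset.mem_erase, Finset.mem_univ, true_and, and_true]
      constructor
      · tauto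
      · intro h
        exact ⟨(h.1.trans ((hJ i hiJ).trans hk)).ne, h⟩
    rw [e]
    exact hle (hc i hiJ)
  · intro q
    have h1 := hle (hP (sum_eval_mem q))
    have hs : s ∈ Finset.univ.erase k := by simp [hk.ne]
    rw [← Finset.add_sum_erase _ _ (Finset.mem_univ k), ← Finset.add_sum_erase _ _ hs] at h1
    rw [← Finset.add_sum_erase _ _ hs]
    have h2 : ∑ l ∈ (Finset.univ.erase k).erase s, (((if l = s then 2 else 1 : ℕ)) : K) •
        (X l * q.eval (X l)) = ∑ l ∈ (Finset.univ.erase k).erase s, (X l : MvPolynomial (Fin n) K) * q.eval (X l) := by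
      refine Finset.sum_congr rfl fun l hl => ?_
      rw [if_neg (Finset.ne_of_mem_erase hl)]; simp
    rw [h2]
    simp only [if_true]
    have h3 : (X s * q.eval (X s) - X k * q.eval (X k) : MvPolynomial (Fin n) K) ∈
        𝔠 ⊔ Ideal.span {X s - X k} := by
      have := Polynomial.sub_dvd_eval_sub (X s : MvPolynomial (Fin n) K) (X k) (Polynomial.X * q)
      simp only [Polynomial.eval_mul, Polynomial.eval_X] at this
      exact poly_dvd_aux this hsk
    have := Ideal.add_mem _ h1 h3
    convert this using 1
    rw [Nat.cast_ofNat, ofNat_smul_eq_nsmul, two_nsmul]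
    ring
  · intro q; simp

end
end SArt

namespace SArt
section
universe u

lemma tower {K : Type u} [Field K] (n : ℕ) : ∀ (B : Type u) [CommRing B] [Algebra K B] [Module.Finite K B] [Nontrivial B]
    (P : Polynomial B), P.Monic → P.natDegree = n →
    ∃ (C : Type u) (_ : CommRing C) (_ : Algebra K C) (f : B →ₐ[K] C) (x : Fin n → C),
      P.map (f : B →+* C) = ∏ i, (Polynomial.X - Polynomial.C (x i)) ∧
      Module.finrank K C = n.factorial * Module.finrank K B ∧
      Algebra.adjoin K (Set.range f ∪ Set.range x) = ⊤ ∧ Module.Finite K C := by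
  induction n with
  | zero =>
    intro B _ _ _ _ P hP hd
    refine ⟨B, inferInstance, inferInstance, AlgHom.id K B, Fin.elim0, ?_, by simp, ?_, inferInstance⟩
    · rw [Polynomial.eq_one_of_monic_natDegree_zero hP hd]; simp
    · rw [eq_top_iff]
      intro b _
      exact Algebra.subset_adjoin (Or.inl ⟨b, rfl⟩)
  | succ n ih =>
    intro B _ _ _ _ P hP hd
    have : Module.Free B (AdjoinRoot P) := .of_basis (AdjoinRoot.powerBasis' hP).basis
    have : Module.Finite B (AdjoinRoot P) := .of_basis (AdjoinRoot.powerBasis' hP).basis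
    have hfr : Module.finrank B (AdjoinRoot P) = n + 1 := by
      rw [(AdjoinRoot.powerBasis' hP).finrank, AdjoinRoot.powerBasis'_dim, hd]
    have : Nontrivial (AdjoinRoot P) := Module.nontrivial_of_finrank_pos (R := B) (by omega)
    have : Module.Finite K (AdjoinRoot P) := Module.Finite.trans B _
    have hfr2 : Module.finrank K (AdjoinRoot P) = Module.finrank K B * (n + 1) := by
      rw [← hfr, Module.finrank_mul_finrank]
    set P' := P.map (AdjoinRoot.of P)
    have hroot : P'.IsRoot (AdjoinRoot.root P) := AdjoinRoot.isRoot_root P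
    have hm := Polynomial.mul_divByMonic_eq_iff_isRoot.2 hroot
    have hP' : P'.Monic := hP.map _
    have hQ : (P' /ₘ (Polynomial.X - Polynomial.C (AdjoinRoot.root P))).Monic := by
      rw [← hm] at hP'
      exact (Polynomial.monic_X_sub_C _).of_mul_monic_left hP'
    have hQd : (P' /ₘ (Polynomial.X - Polynomial.C (AdjoinRoot.root P))).natDegree = n := by
      rw [Polynomial.natDegree_divByMonic _ (Polynomial.monic_X_sub_C _), hP.natDegree_map, hd,
        Polynomial.natDegree_X_sub_C]; simp
    obtain ⟨C, i1, i2, f, x, hf, hC, had, hfin⟩ := ih (AdjoinRoot P) _ hQ hQd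
    refine ⟨C, i1, i2, f.comp (AdjoinRoot.ofAlgHom K P), Fin.cons (f (AdjoinRoot.root P)) x, ?_, ?_, ?_, hfin⟩
    · rw [Fin.prod_univ_succ]
      simp only [Fin.cons_zero, Fin.cons_succ]
      rw [← hf]
      have : P.map ((f.comp (AdjoinRoot.ofAlgHom K P) : B →ₐ[K] C) : B →+* C) = P'.map (f : AdjoinRoot P →+* C) := by
        rw [Polynomial.map_map]; rfl
      rw [this]
      conv_lhs => rw [← hm]
      simp [Polynomial.map_mul]
    · rw [hC, hfr2, Nat.factorial_succ]; ring
    · rw [eq_top_iff, ← had]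
      refine Algebra.adjoin_le ?_
      rintro _ (⟨y, rfl⟩ | ⟨i, rfl⟩)
      · induction y using AdjoinRoot.induction_on with
        | ih q =>
          induction q using Polynomial.induction_on' with
          | add p q hp hq => rw [map_add, map_add]; exact add_mem hp hq
          | monomial r a =>
            rw [← Polynomial.C_mul_X_pow_eq_monomial, map_mul, map_pow, map_mul, map_pow]
            have h1 : f (AdjoinRoot.mk P (Polynomial.C a)) ∈ Algebra.adjoin K
                (Set.range (f.comp (AdjoinRoot.ofAlgHom K P)) ∪
                  Set.range (Fin.cons (f (AdjoinRoot.root P)) x : Fin (n + 1) → C)) :=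
              Algebra.subset_adjoin (Or.inl ⟨a, rfl⟩)
            have h2 : f (AdjoinRoot.mk P Polynomial.X) ∈ Algebra.adjoin K
                (Set.range (f.comp (AdjoinRoot.ofAlgHom K P)) ∪
                  Set.range (Fin.cons (f (AdjoinRoot.root P)) x : Fin (n + 1) → C)) :=
              Algebra.subset_adjoin (Or.inr ⟨0, rfl⟩)
            exact mul_mem h1 (pow_mem h2 _)
      · exact Algebra.subset_adjoin (Or.inr ⟨i.succ, rfl⟩)

lemma base_aux {K C : Type*} [Field K] [CommRing C] [Algebra K C] (n d : ℕ) (x : Fin n → C)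
    (hf : ∏ i, (Polynomial.X - Polynomial.C (x i)) = Polynomial.X ^ n)
    (hC : Module.finrank K C = n.factorial)
    (hsurj : Function.Surjective (aeval x : MvPolynomial (Fin n) K →ₐ[K] C))
    (h : Cov K (pIdeal K n) d) : n.factorial ≤ d := by
  classical
  have hes : ∀ k, 0 < k → aeval x (esymm (Fin n) K k) = 0 := by
    intro k hk
    by_cases hkn : k ≤ n
    · rw [aeval_esymm_eq_multiset_esymm]
      have h1 := Multiset.prod_X_sub_C_coeff (Finset.univ.val.map x) (k := n - k) (by simp)
      have h2 : ((Finset.univ.val.map x).map fun t => Polynomial.X - Polynomial.C t).prod = Polynomial.X ^ n := by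
        rw [Multiset.map_map]
        change ∏ i, (Polynomial.X - Polynomial.C (x i)) = _
        exact hf
      rw [h2, Polynomial.coeff_X_pow, if_neg (by omega)] at h1
      have h3 : n - (n - k) = k := by omega
      simp only [Multiset.card_map, Finset.card_val, Finset.card_univ, Fintype.card_fin, h3] at h1
      have h4 := congrArg ((-1) ^ k * ·) h1
      simp only [mul_zero, ← mul_assoc, ← mul_pow] at h4
      simpa using h4.symm
    · rw [esymm, Finset.powersetCard_eq_empty.2 (by simpa using hkn)]; simp
  have hps : ∀ k, 0 < k → aeval x (psum (Fin n) K k) = 0 := by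
    intro k hk
    rw [psum_eq_mul_esymm_sub_sum _ _ k hk, map_sub, map_mul, hes k hk, map_sum]
    rw [Finset.sum_eq_zero]
    · simp
    · intro a ha
      rw [Finset.mem_filter] at ha
      rw [map_mul, map_mul, hes _ ha.2.1]; simp
  have hker : ∀ p ∈ pIdeal K n, aeval x p = 0 := by
    intro p hp
    have : pIdeal K n ≤ RingHom.ker (aeval x : MvPolynomial (Fin n) K →ₐ[K] C) := by
      rw [pIdeal, Ideal.span_le]
      rintro _ ⟨r, rfl⟩
      have := hps (r + 1) (by omega)
      simpa [psum] using this
    exact this hp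
  obtain ⟨B, hB, h⟩ := h
  have hsp : Submodule.span K ((B.image (aeval x) : Finset C) : Set C) = ⊤ := by
    rw [eq_top_iff]
    intro c _
    obtain ⟨p, rfl⟩ := hsurj c
    obtain ⟨w, hw, hpw⟩ := h p
    have h1 := hker _ hpw
    rw [map_sub, sub_eq_zero] at h1
    rw [h1, Finset.coe_image]
    have := Submodule.mem_map_of_mem (f := (aeval x : MvPolynomial (Fin n) K →ₐ[K] C).toLinearMap) hw
    rw [Submodule.map_span] at this
    exact this
  have h1 := finrank_span_finset_le_card (R := K) (B.image (aeval x))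
  rw [Set.finrank, hsp, finrank_top, hC] at h1
  exact h1.trans (Finset.card_image_le.trans hB)

lemma base_bound {K : Type u} [Field K] (n d : ℕ) (h : Cov K (pIdeal K n) d) : n.factorial ≤ d := by
  obtain ⟨C, i1, i2, f, x, hf, hC, had, hfin⟩ := tower (K := K) n K (Polynomial.X ^ n) (Polynomial.monic_X_pow n)
    (Polynomial.natDegree_X_pow n)
  refine base_aux n d x ?_ ?_ ?_ h
  · rw [← hf]; simp
  · simpa using hC
  · rw [← AlgHom.range_eq_top, eq_top_iff, ← had]
    refine Algebra.adjoin_le ?_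
    rintro _ (⟨y, rfl⟩ | ⟨i, rfl⟩)
    · refine ⟨algebraMap K _ y, ?_⟩
      have : f y = algebraMap K C y := f.commutes y
      rw [this]; simp
    · exact ⟨X i, by simp⟩

end
end SArt

namespace SArt
section
variable {K : Type*} [Field K]

lemma colonI_colonI {S : Type*} [CommRing S] (𝔟 : Ideal S) (y z : S) :
    colonI (colonI 𝔟 y) z = colonI 𝔟 (y * z) := by
  ext p; simp only [mem_colonI, mul_assoc]

lemma colonI_one {S : Type*} [CommRing S] (𝔟 : Ideal S) : colonI 𝔟 1 = 𝔟 := by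
  ext p; simp only [mem_colonI, one_mul]

lemma hgt_insert {n : ℕ} (J : Finset (Fin n)) (s i : Fin n) (hJ : ∀ j ∈ J, j < s) :
    hgt (insert s J) Finset.univ Finset.univ i = hgt J Finset.univ Finset.univ i - if s < i then 1 else 0 := by
  have hs : s ∉ J := fun h => lt_irrefl _ (hJ s h)
  have e : Finset.univ.filter (fun l => l < i ∧ l ∉ insert s J) =
    (Finset.univ.filter (fun l => l < i ∧ l ∉ J)).erase s := by
    ext l; simp; tauto
  simp only [hgt]
  rw [e]
  split_ifs with h1 h2 h2
  · rw [Finset.card_erase_of_mem (by simp [h2, hs])]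
    have : 0 < (Finset.univ.filter (fun l => l < i ∧ l ∉ J)).card :=
      Finset.card_pos.2 ⟨s, by simp [h2, hs]⟩
    omega
  · rw [Finset.erase_eq_of_notMem (by simp [h2])]; simp
  all_goals simp at h1

lemma hgt_erase {n : ℕ} (J : Finset (Fin n)) (k i : Fin n) (hk : k ∉ J) (hi : i ≠ k) :
    hgt J (Finset.univ.erase k) (Finset.univ.erase k) i =
      hgt J Finset.univ Finset.univ i - if k < i then 1 else 0 := by
  have e : (Finset.univ.erase k).filter (fun l => l < i ∧ l ∉ J) =
    (Finset.univ.filter (fun l => l < i ∧ l ∉ J)).erase k := by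
    ext l; simp
  simp only [hgt]
  rw [e]
  simp only [Finset.mem_erase, hi, Finset.mem_univ, ne_eq, not_false_eq_true, and_self, if_true]
  split_ifs with h2
  · rw [Finset.card_erase_of_mem (by simp [h2, hk])]
    have : 0 < (Finset.univ.filter (fun l => l < i ∧ l ∉ J)).card :=
      Finset.card_pos.2 ⟨k, by simp [h2, hk]⟩
    omega
  · rw [Finset.erase_eq_of_notMem (by simp [h2])]; simp

lemma lower_aux [CharZero K] {n : ℕ} (J : Finset (Fin n)) (s : Fin n) (hJ : ∀ j ∈ J, j < s)
    (ih : ∀ d, Cov K (colonI (pIdeal K n) (gJ K J)) d → ∏ i, hgt J Finset.univ Finset.univ i ≤ d) (u : ℕ) :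
    ∀ d, Cov K (colonI (pIdeal K n) (gJ K J *
        ∏ l ∈ Finset.univ.filter (fun l : Fin n => s < l ∧ n ≤ l + u), (X s - X l))) d →
      ∏ i : Fin n, (hgt J Finset.univ Finset.univ i - if s < i ∧ n ≤ i + u then 1 else 0) ≤ d := by
  induction u with
  | zero =>
    intro d h
    have e : ∀ i : Fin n, ¬ (s < i ∧ n ≤ i + 0) := fun i => by omega
    simp only [e] at h ⊢
    simp only [Finset.filter_false, Finset.prod_empty, mul_one] at h
    simpa using ih d h
  | succ u ihu =>
    intro d h
    by_cases hk : s.1 + u + 1 < n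
    · set k : Fin n := ⟨n - 1 - u, by omega⟩ with hkdef
      have hkv : k.1 + u + 1 = n := by simp [hkdef]; omega
      have hsk : s < k := by rw [Fin.lt_def]; omega
      have hkJ : k ∉ J := fun h => lt_asymm (hJ k h) hsk
      have e : Finset.univ.filter (fun l : Fin n => s < l ∧ n ≤ l + (u + 1)) =
        insert k (Finset.univ.filter (fun l : Fin n => s < l ∧ n ≤ l + u)) := by
        ext l
        simp only [Finset.mem_filter, Finset.mem_univ, true_and, Finset.mem_insert, Fin.ext_iff, Fin.lt_def]
        rw [Fin.lt_def] at hsk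
        omega
      have hkn : k ∉ Finset.univ.filter (fun l : Fin n => s < l ∧ n ≤ l + u) := by
        simp; omega
      rw [e, Finset.prod_insert hkn, mul_comm (X s - X k), ← mul_assoc, ← colonI_colonI] at h
      have hcov := cov_of_hyp (hyp_contract J s k hJ hsk (colonI (pIdeal K n) (gJ K J *
        ∏ l ∈ Finset.univ.filter (fun l : Fin n => s < l ∧ n ≤ l + u), (X s - X l))) (le_colonI _ _) (fun i hi => by
        rw [mem_colonI, mul_right_comm]
        exact Ideal.mul_mem_right _ _ (gJ_mem (K := K) J hi)))
      have h2 := ihu _ (cov_chain h hcov)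
      have hE : ∏ i ∈ Finset.univ.erase k, hgt J (Finset.univ.erase k) (Finset.univ.erase k) i =
          ∏ i ∈ Finset.univ.erase k, (hgt J Finset.univ Finset.univ i - if s < i ∧ n ≤ i + u then 1 else 0) := by
        refine Finset.prod_congr rfl fun i hi => ?_
        have hik := Finset.ne_of_mem_erase hi
        rw [hgt_erase J k i hkJ hik]
        have : k < i ↔ s < i ∧ n ≤ i + u := by
          simp only [Fin.lt_def, ne_eq, Fin.ext_iff] at *
          omega
        simp only [this]
      have hE' : ∏ i ∈ Finset.univ.erase k, (hgt J Finset.univ Finset.univ i - if s < i ∧ n ≤ i + u then 1 else 0)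
          = ∏ i ∈ Finset.univ.erase k, (hgt J Finset.univ Finset.univ i - if s < i ∧ n ≤ i + (u+1) then 1 else 0) := by
        refine Finset.prod_congr rfl fun i hi => ?_
        have hik := Finset.ne_of_mem_erase hi
        have : (s < i ∧ n ≤ i + u) ↔ (s < i ∧ n ≤ i + (u+1)) := by
          simp only [Fin.lt_def, ne_eq, Fin.ext_iff] at *
          omega
        simp only [this]
      rw [hE, ← Finset.mul_prod_erase _ _ (Finset.mem_univ k)] at h2
      rw [← Finset.mul_prod_erase _ _ (Finset.mem_univ k), ← hE']
      rw [if_neg (by omega)] at h2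
      rw [if_pos ⟨hsk, by omega⟩, Nat.sub_mul]
      rw [Nat.sub_zero] at h2
      omega
    · have e : ∀ l : Fin n, (s < l ∧ n ≤ l + (u + 1)) ↔ (s < l ∧ n ≤ l + u) := by
        intro l; rw [Fin.lt_def]; omega
      simp only [e] at h ⊢
      exact ihu d h

theorem lower {K : Type*} [Field K] [CharZero K] {n : ℕ} (J : Finset (Fin n)) :
    ∀ d, Cov K (colonI (pIdeal K n) (gJ K J)) d → ∏ i, hgt J Finset.univ Finset.univ i ≤ d := by
  induction J using Finset.induction_on_max with
  | empty =>
    intro d h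
    rw [gJ, Finset.prod_empty, colonI_one] at h
    have h1 := base_bound n d h
    have : ∀ i : Fin n, hgt ∅ Finset.univ Finset.univ i = i + 1 := by
      intro i
      simp [hgt]
      rw [Finset.filter_gt_eq_Iio]
      simp
    simp only [this]
    rw [Fin.prod_univ_eq_prod_range (fun i => i + 1), Finset.prod_range_add_one_eq_factorial]
    exact h1
  | insert s J hJ ih =>
    intro d h
    have hs : s ∉ J := fun h => lt_irrefl _ (hJ s h)
    have := lower_aux J s hJ ih n d
    have e : ∀ l : Fin n, (s < l ∧ n ≤ l + n) ↔ s < l := fun l => by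
      simp
    simp only [e] at this
    simp only [hgt_insert J s _ hJ]
    apply this
    rw [Finset.filter_lt_eq_Ioi, mul_comm]
    rwa [gJ, Finset.prod_insert hs] at h

end
end SArt

namespace SArt
section
variable {K : Type*} [Field K]

lemma cov_drop {α S : Type*} [DecidableEq α] [CommRing S] [Algebra K S] {𝔟 : Ideal S} (T : Finset α) (m : α → S)
    (hT : ∀ p : S, ∃ w ∈ Submodule.span K (m '' T), p - w ∈ 𝔟) (a0 : α)
    (h0 : ∃ w ∈ Submodule.span K (m '' (T.erase a0 : Finset α)), m a0 - w ∈ 𝔟) (ha : a0 ∈ T) :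
    Cov K 𝔟 (T.card - 1) := by
  classical
  refine ⟨(T.erase a0).image m, Finset.card_image_le.trans (by rw [Finset.card_erase_of_mem ha]), ?_⟩
  intro p
  rw [Finset.coe_image]
  have key : ∀ w ∈ Submodule.span K (m '' T),
      ∃ w' ∈ Submodule.span K (m '' (T.erase a0 : Finset α)), w - w' ∈ 𝔟 := by
    intro w hw
    induction hw using Submodule.span_induction with
    | mem x hx =>
      obtain ⟨a, haT, rfl⟩ := hx
      by_cases h : a = a0
      · subst h; exact h0
      · exact ⟨m a, Submodule.subset_span ⟨a, by simpa [h] using haT, rfl⟩, by simp⟩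
    | zero => exact ⟨0, Submodule.zero_mem _, by simp⟩
    | add x y _ _ hx hy =>
      obtain ⟨x', hx', hx⟩ := hx
      obtain ⟨y', hy', hy⟩ := hy
      refine ⟨x' + y', Submodule.add_mem _ hx' hy', ?_⟩
      rw [add_sub_add_comm]; exact 𝔟.add_mem hx hy
    | smul r x _ hx =>
      obtain ⟨x', hx', hx⟩ := hx
      refine ⟨r • x', Submodule.smul_mem _ _ hx', ?_⟩
      rw [← smul_sub]; exact smul_mem_I r hx
  obtain ⟨w, hw, hp⟩ := hT p
  obtain ⟨w', hw', hww⟩ := key w hw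
  refine ⟨w', hw', ?_⟩
  rw [← sub_add_sub_cancel p w w']
  exact 𝔟.add_mem hp hww

def mon (K : Type*) [Field K] {n : ℕ} (a : Fin n → ℕ) : MvPolynomial (Fin n) K := ∏ i, X i ^ a i

lemma mon_eq {n : ℕ} (a : Fin n → ℕ) :
    (monomial (Finsupp.equivFunOnFinite.symm a) (1 : K)) = mon K a := by
  rw [monomial_eq, map_one, one_mul, Finsupp.prod_fintype _ _ (by simp)]; rfl

lemma hyp_lower [CharZero K] {n : ℕ} (J : Finset (Fin n)) :
    Hyp (fun i => (X i : MvPolynomial (Fin n) K)) (fun _ => (1 : K)) J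
      Finset.univ Finset.univ (colonI (pIdeal K n) (gJ K J)) := by
  refine ⟨subset_rfl, fun _ _ l hl _ => hl, ?_, ?_, ?_, ?_, ?_⟩
  · intro B _ hB
    simp [hB.card_ne_zero]
  · apply sub_const_mem
    intro i
    exact Ideal.mem_sup_right (Ideal.subset_span ⟨i, by simp, rfl⟩)
  · intro i hi hiJ
    rw [if_pos hi, mem_colonI]
    exact gJ_mem J hiJ
  · intro q
    simp only [one_smul]
    exact le_colonI _ _ (sum_eval_mem q)
  · intro q; simp

lemma indep_aux [CharZero K] {n : ℕ} (J : Finset (Fin n)) {α : Type*} (U : Finset α) (φ : α → Fin n → ℕ)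
    (hinj : ∀ u ∈ U, ∀ v ∈ U, φ u = φ v → u = v) (hφ : ∀ u ∈ U, ∀ i, φ u i < hgt J Finset.univ Finset.univ i)
    (c : α → K) (h : gJ K J * ∑ u ∈ U, c u • mon K (φ u) ∈ pIdeal K n) : ∀ u ∈ U, c u = 0 := by
  classical
  intro u0 hu0
  by_contra hc
  set T : Finset (Fin n → ℕ) := Fintype.piFinset fun i => Finset.range (hgt J Finset.univ Finset.univ i) with hT
  have hmem : ∀ u ∈ U, φ u ∈ T := by
    intro u hu
    rw [hT, Fintype.mem_piFinset]
    intro i; simpa using hφ u hu i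
  have hcard : T.card = ∏ i, hgt J Finset.univ Finset.univ i := by
    rw [hT, Fintype.card_piFinset]; simp
  have hcov : Cov K (colonI (pIdeal K n) (gJ K J)) (T.card - 1) := by
    refine cov_drop T (mon K) ?_ (φ u0) ?_ (hmem u0 hu0)
    · intro p
      obtain ⟨w, hw, hp⟩ := spanning (hyp_lower J) p
      refine ⟨w, Submodule.span_mono ?_ hw, hp⟩
      rintro _ ⟨a, ha, rfl⟩
      refine ⟨a, ?_, rfl⟩
      rw [hT, Finset.mem_coe, Fintype.mem_piFinset]
      intro i; simpa using ha i (Finset.mem_univ i)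
    · refine ⟨- ∑ u ∈ U.erase u0, ((c u0)⁻¹ * c u) • mon K (φ u), ?_, ?_⟩
      · refine Submodule.neg_mem _ (Submodule.sum_mem _ fun u hu => Submodule.smul_mem _ _
          (Submodule.subset_span ⟨φ u, ?_, rfl⟩))
        rw [Finset.mem_erase] at hu
        rw [Finset.mem_coe, Finset.mem_erase]
        exact ⟨fun he => hu.1 (hinj _ hu.2 _ hu0 he), hmem u hu.2⟩
      · have h1 := smul_mem_I (c u0)⁻¹ ((mem_colonI _ _ _).2 h)
        convert h1 using 1
        rw [← Finset.add_sum_erase _ _ hu0, smul_add, smul_smul, inv_mul_cancel₀ hc, one_smul, sub_neg_eq_add,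
          Finset.smul_sum]
        simp only [smul_smul]
  have h2 := lower J _ hcov
  have h3 : 0 < T.card := Finset.card_pos.2 ⟨_, hmem u0 hu0⟩
  omega

def fJ (K : Type*) [Field K] {n : ℕ} (J : Finset (Fin n)) : MvPolynomial (Fin n) K :=
  ∏ j ∈ J, (X j * ∏ i ∈ Finset.Ioi j, (X j - X i))

lemma hgt_stair {n : ℕ} (J : Finset (Fin n)) (i : Fin n) :
    hgt J Finset.univ Finset.univ i = stair J i + if i ∈ J then 1 else 0 := by
  simp only [hgt, stair, Finset.mem_univ, if_true]
  by_cases hi : i ∈ J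
  · simp only [hi, if_true]
    congr 2
    ext l
    simp only [Finset.mem_filter, Finset.mem_univ, true_and]
    constructor
    · rintro ⟨h1, h2⟩; exact ⟨h1.le, h2⟩
    · rintro ⟨h1, h2⟩; exact ⟨lt_of_le_of_ne h1 (by rintro rfl; exact h2 hi), h2⟩
  · simp only [hi, if_false]
    have : Finset.univ.filter (fun k => k ≤ i ∧ k ∉ J) =
      insert i (Finset.univ.filter (fun k => k < i ∧ k ∉ J)) := by
      ext l
      simp only [Finset.mem_filter, Finset.mem_univ, true_and, Finset.mem_insert]
      constructor
      · rintro ⟨h1, h2⟩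
        rcases h1.eq_or_lt with h | h
        · exact Or.inl h
        · exact Or.inr ⟨h, h2⟩
      · rintro (rfl | ⟨h1, h2⟩)
        · exact ⟨le_rfl, hi⟩
        · exact ⟨h1.le, h2⟩
    rw [this, Finset.card_insert_of_notMem (by simp)]

theorem indep [CharZero K] {n : ℕ} (J : Finset (Fin n)) (U : Finset (Fin n → ℕ))
    (hU : ∀ a ∈ U, ∀ i, a i < stair J i)
    (c : (Fin n → ℕ) → K) (h : fJ K J * ∑ a ∈ U, c a • mon K a ∈ pIdeal K n) : ∀ a ∈ U, c a = 0 := by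
  refine indep_aux J U (fun a i => a i + if i ∈ J then 1 else 0) ?_ ?_ c ?_
  · intro u _ v _ huv
    funext i
    have := congrFun huv i
    simpa using this
  · intro u hu i
    rw [hgt_stair]
    have := hU u hu i
    omega
  · convert h using 1
    have e : fJ K J = gJ K J * ∏ j, X j ^ (if j ∈ J then 1 else 0) := by
      rw [fJ, Finset.prod_mul_distrib, mul_comm, gJ]
      congr 1
      simp
    rw [e, mul_assoc]
    congr 1
    rw [Finset.mul_sum]
    refine Finset.sum_congr rfl fun a _ => ?_
    rw [mul_smul_comm]
    congr 1
    simp only [mon, pow_add, Finset.prod_mul_distrib]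
    rw [mul_comm]

end
end SArt

namespace SArt
section
variable {K : Type*} [Field K]

lemma sum_eval_mem' {n : ℕ} (Q : Polynomial (MvPolynomial (Fin n) K)) :
    ∑ l : Fin n, Q.eval (X l) - n • Q.eval 0 ∈ pIdeal K n := by
  have h := sum_eval_mem (K := K) Q.divX
  convert h using 1
  have : ∀ l : Fin n, Q.eval (X l) = X l * Q.divX.eval (X l) + Q.eval 0 := by
    intro l
    conv_lhs => rw [← Polynomial.X_mul_divX_add Q]
    simp [Polynomial.coeff_zero_eq_eval_zero]
  simp only [this, Finset.sum_add_distrib]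
  simp

def shX (K : Type*) [Field K] (m : ℕ) : Fin (m + 1) → MvPolynomial (Fin (m + 1)) K :=
  Fin.snoc (α := fun _ => MvPolynomial (Fin (m + 1)) K) (fun i : Fin m => X i.succ - X 0) (- X 0)

lemma shX_castSucc {m : ℕ} (i : Fin m) : shX K m i.castSucc = X i.succ - X 0 := by simp [shX]
lemma shX_last {m : ℕ} : shX K m (Fin.last m) = - X 0 := by simp [shX]

def shJ {m : ℕ} (J : Finset (Fin (m + 1))) : Finset (Fin (m + 1)) :=
  insert (Fin.last m) ((Finset.univ.filter (fun i : Fin m => i.succ ∈ J)).map Fin.castSuccEmb)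

lemma last_mem_shJ {m : ℕ} (J : Finset (Fin (m + 1))) : Fin.last m ∈ shJ J := by simp [shJ]
lemma castSucc_mem_shJ {m : ℕ} (J : Finset (Fin (m + 1))) (i : Fin m) :
    i.castSucc ∈ shJ J ↔ i.succ ∈ J := by
  simp [shJ, (Fin.castSucc_lt_last i).ne]

lemma hgt_shJ {m : ℕ} (J : Finset (Fin (m + 1))) (h0 : 0 ∉ J) (i : Fin (m + 1)) :
    hgt (shJ J) Finset.univ Finset.univ i = stair J i := by
  simp only [hgt, stair, Finset.card_filter]
  rw [Fin.sum_univ_castSucc, Fin.sum_univ_succ]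
  simp only [castSucc_mem_shJ, last_mem_shJ, not_true, and_false, if_false, add_zero, Fin.zero_le, true_and, h0,
    not_false_eq_true, if_true, Finset.mem_univ]
  rw [add_comm]
  congr 1

theorem upperS [CharZero K] {m : ℕ} (J : Finset (Fin (m + 1))) (𝔟 : Ideal (MvPolynomial (Fin (m + 1)) K))
    (hP : pIdeal K (m + 1) ≤ 𝔟)
    (hJ : ∀ i ∈ J, ∏ l ∈ Finset.univ.filter (fun l => l < i ∧ l ∉ J), (X i - X l) ∈ 𝔟) :
    Cov K 𝔟 (∏ i, stair J i) := by
  by_cases h0 : 0 ∈ J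
  · have h1 := hJ 0 h0
    simp only [Fin.not_lt_zero, false_and, Finset.filter_false, Finset.prod_empty] at h1
    exact ⟨∅, by simp, fun p => ⟨0, Submodule.zero_mem _, by rw [(Ideal.eq_top_iff_one _).2 h1]; trivial⟩⟩
  have hhyp : Hyp (shX K m) (fun i => if i = Fin.last m then -((m + 1 : ℕ) : K) else 1) (shJ J) Finset.univ
      Finset.univ 𝔟 := by
    refine ⟨subset_rfl, fun _ _ l hl _ => hl, ?_, ?_, ?_, ?_, ?_⟩
    · intro B _ hB
      by_cases hl : Fin.last m ∈ B
      · rw [← Finset.add_sum_erase _ _ hl, if_pos rfl, Finset.sum_congr rfl (g := fun _ => (1 : K))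
          (fun i hi => if_neg (Finset.ne_of_mem_erase hi))]
        rw [Finset.sum_const, nsmul_one, neg_add_eq_sub, sub_ne_zero, Nat.cast_injective.ne_iff,
          Finset.card_erase_of_mem hl]
        have := Finset.card_le_univ B
        rw [Fintype.card_fin] at this
        omega
      · rw [Finset.sum_congr rfl (g := fun _ => (1 : K))
          (fun i hi => if_neg (by rintro rfl; exact hl hi))]
        simp [hB.card_ne_zero]
    · apply sub_const_mem
      have hx0 : (X 0 : MvPolynomial (Fin (m + 1)) K) ∈
          𝔟 ⊔ Ideal.span (shX K m '' (Finset.univ : Finset (Fin (m + 1)))) := by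
        rw [← neg_mem_iff, ← shX_last]
        exact Ideal.mem_sup_right (Ideal.subset_span ⟨_, by simp, rfl⟩)
      intro i
      refine Fin.cases hx0 (fun i => ?_) i
      have h1 : shX K m i.castSucc ∈
          𝔟 ⊔ Ideal.span (shX K m '' (Finset.univ : Finset (Fin (m + 1)))) :=
        Ideal.mem_sup_right (Ideal.subset_span ⟨_, by simp, rfl⟩)
      have h2 := Ideal.add_mem _ h1 hx0
      rwa [shX_castSucc, sub_add_cancel] at h2
    · intro i hi
      rw [if_pos hi, Finset.prod_filter, Fin.prod_univ_castSucc]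
      simp only [castSucc_mem_shJ, last_mem_shJ, not_true, and_false, if_false, mul_one, shX_castSucc]
      refine Fin.lastCases ?_ (fun i => ?_) i
      · intro _
        simp only [shX_last, Fin.castSucc_lt_last, true_and]
        set g : Polynomial (MvPolynomial (Fin (m + 1)) K) :=
          ∏ l ∈ Finset.univ.filter (fun l => l ∉ J), (Polynomial.X - Polynomial.C (X l)) with hg
        have hg1 : ∀ l, g.eval (X l) ∈ 𝔟 := by
          intro l
          rw [hg, Polynomial.eval_prod]
          simp only [Polynomial.eval_sub, Polynomial.eval_X, Polynomial.eval_C]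
          by_cases hl : l ∈ J
          · refine poly_dvd_aux (Finset.prod_dvd_prod_of_subset _ _ _ ?_) (hJ l hl)
            intro k hk
            simp only [Finset.mem_filter] at hk ⊢
            exact ⟨hk.1, hk.2.2⟩
          · rw [Finset.prod_eq_zero (i := l) (by simpa using hl) (by simp)]
            exact 𝔟.zero_mem
        have hg2 : g.eval 0 ∈ 𝔟 := by
          have h1 := hP (sum_eval_mem' (K := K) g)
          have h2 := 𝔟.sub_mem (𝔟.sum_mem (fun l _ => hg1 l) (t := Finset.univ)) h1
          rw [sub_sub_cancel] at h2
          have h3 := smul_mem_I (((m + 1 : ℕ) : K)⁻¹) h2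
          rwa [← Nat.cast_smul_eq_nsmul K, smul_smul, inv_mul_cancel₀ (by exact_mod_cast Nat.succ_ne_zero m),
            one_smul] at h3
        convert hg2 using 1
        rw [hg, Polynomial.eval_prod, Finset.prod_filter, Fin.prod_univ_succ]
        simp [h0]
        refine Finset.prod_congr rfl fun x _ => ?_
        congr 1
        ring
      · intro hiJ
        rw [castSucc_mem_shJ] at hiJ
        have h1 := hJ _ hiJ
        convert h1 using 1
        rw [Finset.prod_filter, Fin.prod_univ_succ]
        simp [h0, shX_castSucc]
    · intro q
      have h1 := hP (sum_eval_mem' (K := K) ((Polynomial.X * q).comp (Polynomial.X - Polynomial.C (X 0))))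
      rw [Fin.sum_univ_succ] at h1
      rw [Fin.sum_univ_castSucc]
      convert h1 using 1
      simp [(Fin.castSucc_lt_last _).ne, shX_castSucc, shX_last, Algebra.smul_def]
      ring
    · intro q; simp
  have := cov_of_hyp hhyp
  simpa only [hgt_shJ J h0] using this

end
end SArt

namespace SArt
section
variable {K : Type*} [Field K] {n : ℕ}

def xx (K : Type*) [Field K] {n : ℕ} (i : Fin n) : SuperRing K n := X i ⊗ₜ[K] 1
def th (K : Type*) [Field K] {n : ℕ} (i : Fin n) : SuperRing K n :=
  1 ⊗ₜ[K] ExteriorAlgebra.ι K (Pi.single i (1 : K))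

lemma poly_comm (p : MvPolynomial (Fin n) K) (z : SuperRing K n) :
    (p ⊗ₜ[K] (1 : ExteriorAlgebra K (Fin n → K))) * z = z * (p ⊗ₜ[K] 1) := by
  induction z using TensorProduct.induction_on with
  | zero => simp
  | tmul q l => simp [mul_comm]
  | add a b ha hb => rw [mul_add, add_mul, ha, hb]

lemma xx_comm (i : Fin n) (z : SuperRing K n) : xx K i * z = z * xx K i := poly_comm _ z

lemma th_sq (i : Fin n) : th K i * th K i = 0 := by
  simp [th]

lemma th_anti (i j : Fin n) : th K i * th K j = (-1 : K) • (th K j * th K i) := by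
  have := ExteriorAlgebra.ι_add_mul_swap (R := K) (Pi.single i (1 : K)) (Pi.single j (1 : K) : Fin n → K)
  rw [th, th, Algebra.TensorProduct.tmul_mul_tmul, Algebra.TensorProduct.tmul_mul_tmul,
    eq_neg_of_add_eq_zero_left this, ← neg_one_smul K, TensorProduct.tmul_smul]

lemma permAct_xx (w : Equiv.Perm (Fin n)) (i : Fin n) : permAct K n w (xx K i) = xx K (w i) := by
  simp [permAct, xx]

lemma permAct_th (w : Equiv.Perm (Fin n)) (i : Fin n) : permAct K n w (th K i) = th K (w i) := by
  have : LinearMap.funLeft K K ⇑w⁻¹ (Pi.single i (1 : K)) = Pi.single (w i) 1 := by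
    ext j
    simp only [LinearMap.funLeft_apply, Pi.single_apply]
    congr 1
    rw [Equiv.Perm.inv_eq_iff_eq, eq_comm]
  rw [permAct, th, Algebra.TensorProduct.map_tmul, ExteriorAlgebra.map_apply_ι, this, map_one, th]

def gens (K : Type*) [Field K] {n : ℕ} (B : Finset (Fin n)) : Set (SuperRing K n) :=
  {z | ∃ i ∈ B, z = xx K i ∨ z = th K i}

lemma adjoin_gens_univ : Algebra.adjoin K (gens K (Finset.univ : Finset (Fin n))) = ⊤ := by
  rw [eq_top_iff]
  intro z _
  induction z using TensorProduct.induction_on with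
  | zero => exact Subalgebra.zero_mem _
  | add a b ha hb => exact Subalgebra.add_mem _ (ha trivial) (hb trivial)
  | tmul p l =>
    have e : p ⊗ₜ[K] l = (p ⊗ₜ[K] (1 : ExteriorAlgebra K (Fin n → K))) * (1 ⊗ₜ[K] l) := by simp
    rw [e]
    clear e
    refine Subalgebra.mul_mem _ ?_ ?_
    · have h : (Algebra.adjoin K (Set.range (X : Fin n → MvPolynomial (Fin n) K))).map
          (Algebra.TensorProduct.includeLeft : MvPolynomial (Fin n) K →ₐ[K] SuperRing K n) ≤
          Algebra.adjoin K (gens K (Finset.univ : Finset (Fin n))) := by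
        rw [AlgHom.map_adjoin]
        refine Algebra.adjoin_mono ?_
        rintro _ ⟨_, ⟨i, rfl⟩, rfl⟩
        exact ⟨i, Finset.mem_univ i, Or.inl rfl⟩
      exact h ⟨p, by rw [MvPolynomial.adjoin_range_X]; trivial, rfl⟩
    · induction l using ExteriorAlgebra.induction with
      | algebraMap r =>
        have : (1 : MvPolynomial (Fin n) K) ⊗ₜ[K] (algebraMap K (ExteriorAlgebra K (Fin n → K)) r) =
          algebraMap K (SuperRing K n) r := by
            rw [Algebra.TensorProduct.algebraMap_apply, Algebra.algebraMap_eq_smul_one,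
              Algebra.algebraMap_eq_smul_one, TensorProduct.tmul_smul, TensorProduct.smul_tmul']
        rw [this]
        exact Subalgebra.algebraMap_mem _ _
      | ι v =>
        have hv : v = ∑ i, v i • Pi.single i (1 : K) := by
          ext j; simp [Finset.sum_apply, Pi.single_apply]
        have : (1 : MvPolynomial (Fin n) K) ⊗ₜ[K] (ExteriorAlgebra.ι K v) = ∑ i, v i • th K i := by
          conv_lhs => rw [hv]
          rw [map_sum, TensorProduct.tmul_sum]
          simp only [map_smul, TensorProduct.tmul_smul, th]
        rw [this]
        refine Subalgebra.sum_mem _ fun i _ => Subalgebra.smul_mem _ (Algebra.subset_adjoin ?_) _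
        exact ⟨i, Finset.mem_univ i, Or.inr rfl⟩
      | mul a b ha hb =>
        have e2 : (1 : MvPolynomial (Fin n) K) ⊗ₜ[K] (a * b) = (1 ⊗ₜ[K] a) * (1 ⊗ₜ[K] b) := by simp
        rw [e2]; exact Subalgebra.mul_mem _ (ha trivial) (hb trivial)
      | add a b ha hb =>
        rw [TensorProduct.tmul_add]; exact Subalgebra.add_mem _ (ha trivial) (hb trivial)

lemma permAct_mul (v w : Equiv.Perm (Fin n)) (z : SuperRing K n) :
    permAct K n (v * w) z = permAct K n v (permAct K n w z) := by
  have : permAct K n (v * w) = (permAct K n v).comp (permAct K n w) := by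
    refine AlgHom.ext_of_adjoin_eq_top adjoin_gens_univ ?_
    rintro _ ⟨i, _, rfl | rfl⟩
    · simp [permAct_xx]
    · simp [permAct_th]
  rw [this]; rfl

lemma permAct_fix (w : Equiv.Perm (Fin n)) (B : Finset (Fin n)) (hw : ∀ i ∈ B, w i = i) {z : SuperRing K n}
    (hz : z ∈ Algebra.adjoin K (gens K B)) : permAct K n w z = z := by
  have : Algebra.adjoin K (gens K B) ≤ AlgHom.equalizer (permAct K n w) (AlgHom.id K _) := by
    refine Algebra.adjoin_le ?_
    rintro _ ⟨i, hi, rfl | rfl⟩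
    · simp [permAct_xx, hw i hi]
    · simp [permAct_th, hw i hi]
  exact this hz

def uu (K : Type*) [Field K] {n : ℕ} (i : Fin n) (a e : ℕ) : SuperRing K n := xx K i ^ a * th K i ^ e

lemma permAct_uu (w : Equiv.Perm (Fin n)) (i : Fin n) (a e : ℕ) :
    permAct K n w (uu K i a e) = uu K (w i) a e := by
  simp [uu, permAct_xx, permAct_th]

def PP (K : Type*) [Field K] (n : ℕ) (a e : ℕ) : SuperRing K n := ∑ j : Fin n, uu K j a e

lemma permAct_PP (w : Equiv.Perm (Fin n)) (a e : ℕ) : permAct K n w (PP K n a e) = PP K n a e := by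
  simp only [PP, map_sum, permAct_uu]
  exact Equiv.sum_comp w (fun j => uu K j a e)

def LL (K : Type*) [Field K] (n : ℕ) : Ideal (SuperRing K n) :=
  Ideal.span {z | ∃ a e : ℕ, 0 < a + e ∧ z = PP K n a e}

lemma PP_mem {a e : ℕ} (h : 0 < a + e) : PP K n a e ∈ LL K n := Ideal.subset_span ⟨a, e, h, rfl⟩

def sym (z : SuperRing K n) : SuperRing K n := ∑ w : Equiv.Perm (Fin n), permAct K n w z

lemma sym_add (y z : SuperRing K n) : sym (y + z) = sym y + sym z := by
  simp [sym, Finset.sum_add_distrib]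
lemma sym_smul (r : K) (z : SuperRing K n) : sym (r • z) = r • sym z := by
  simp [sym, Finset.smul_sum]
lemma sym_act (w : Equiv.Perm (Fin n)) (z : SuperRing K n) : sym (permAct K n w z) = sym z := by
  simp only [sym, ← permAct_mul]
  exact Equiv.sum_comp (Equiv.mulRight w) (fun v => permAct K n v z)
lemma sym_mul_PP (z : SuperRing K n) (a e : ℕ) : sym z * PP K n a e = ∑ j, sym (z * uu K j a e) := by
  simp only [sym]
  rw [Finset.sum_comm, Finset.sum_mul]
  refine Finset.sum_congr rfl fun w _ => ?_
  conv_lhs => rw [← permAct_PP w, ← map_mul, PP, Finset.mul_sum, map_sum]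

/-- `K·1 + L` -/
def KL (K : Type*) [Field K] (n : ℕ) : Submodule K (SuperRing K n) :=
  Submodule.span K {1} ⊔ (LL K n).restrictScalars K

lemma th_pow_mul (i j : Fin n) (e : ℕ) : th K i ^ e * th K j = (-1 : K) ^ e • (th K j * th K i ^ e) := by
  induction e with
  | zero => simp
  | succ e ih =>
    rw [pow_succ, mul_assoc, th_anti i j, mul_smul_comm, ← mul_assoc, ih, pow_succ, smul_mul_assoc, mul_assoc,
      smul_smul, mul_comm]

lemma mem_insert_span (B : Finset (Fin n)) (i : Fin n) {z : SuperRing K n}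
    (hz : z ∈ Algebra.adjoin K (gens K (insert i B))) :
    z ∈ Submodule.span K {y | ∃ z' ∈ Algebra.adjoin K (gens K B), ∃ a e, y = z' * uu K i a e} := by
  set W := Submodule.span K {y | ∃ z' ∈ Algebra.adjoin K (gens K B), ∃ a e, y = z' * uu K i a e} with hW
  have hclosed : ∀ g ∈ gens K (insert i B), ∀ y ∈ W, y * g ∈ W := by
    intro g hg y hy
    have : W ≤ W.comap (LinearMap.mulRight K g) := by
      conv_lhs => rw [hW]
      rw [Submodule.span_le]
      rintro _ ⟨z', hz', a, e, rfl⟩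
      show z' * uu K i a e * g ∈ W
      obtain ⟨j, hj, hg⟩ := hg
      rw [Finset.mem_insert] at hj
      rcases hj with rfl | hj
      · rcases hg with rfl | rfl
        · refine Submodule.subset_span ⟨z', hz', a + 1, e, ?_⟩
          rw [mul_assoc, uu, mul_assoc, ← xx_comm, ← mul_assoc (xx K j ^ a), ← pow_succ, uu]
        · refine Submodule.subset_span ⟨z', hz', a, e + 1, ?_⟩
          rw [mul_assoc, uu, mul_assoc, ← pow_succ, uu]
      · rcases hg with rfl | rfl
        · refine Submodule.subset_span ⟨z' * xx K j, Subalgebra.mul_mem _ hz'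
            (Algebra.subset_adjoin ⟨j, hj, Or.inl rfl⟩), a, e, ?_⟩
          rw [mul_assoc, mul_assoc, xx_comm]
        · have : z' * uu K i a e * th K j = (-1 : K) ^ e • (z' * th K j * uu K i a e) := by
            have hc : xx K i ^ a * th K j = th K j * xx K i ^ a :=
              (show Commute (xx K i) (th K j) from xx_comm i _).pow_left a
            rw [uu, mul_assoc, mul_assoc, th_pow_mul, mul_smul_comm, mul_smul_comm, ← mul_assoc (xx K i ^ a), hc]
            simp only [mul_assoc]
          rw [this]
          exact Submodule.smul_mem _ _ (Submodule.subset_span ⟨z' * th K j, Subalgebra.mul_mem _ hz'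
            (Algebra.subset_adjoin ⟨j, hj, Or.inr rfl⟩), a, e, rfl⟩)
    exact this hy
  have h1 : z ∈ Subalgebra.toSubmodule (Algebra.adjoin K (gens K (insert i B))) := hz
  rw [Algebra.adjoin_eq_span] at h1
  refine (Submodule.span_le.2 ?_) h1
  intro y hy
  induction hy using Submonoid.closure_induction_right with
  | one => exact Submodule.subset_span ⟨1, Subalgebra.one_mem _, 0, 0, by simp [uu]⟩
  | mul_right x _ y hy ih => exact hclosed y hy x ih

lemma sym_mem [CharZero K] (B : Finset (Fin n)) : ∀ z ∈ Algebra.adjoin K (gens K B), sym z ∈ KL K n := by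
  induction B using Finset.induction_on with
  | empty =>
    intro z hz
    have : gens K (∅ : Finset (Fin n)) = ∅ := by ext; simp [gens]
    rw [this, Algebra.adjoin_empty, Algebra.mem_bot] at hz
    obtain ⟨r, rfl⟩ := hz
    refine Submodule.mem_sup_left (Submodule.mem_span_singleton.2 ⟨(Fintype.card (Equiv.Perm (Fin n)) : K) * r, ?_⟩)
    simp only [sym, AlgHom.commutes, Finset.sum_const, Finset.card_univ]
    rw [Algebra.algebraMap_eq_smul_one, mul_smul, Nat.cast_smul_eq_nsmul]
  | insert i B hi ih =>
    intro z hz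
    have := mem_insert_span B i hz
    clear hz
    induction this using Submodule.span_induction with
    | zero => simp [sym]
    | add x y _ _ hx hy => rw [sym_add]; exact Submodule.add_mem _ hx hy
    | smul r x _ hx => rw [sym_smul]; exact Submodule.smul_mem _ _ hx
    | mem y hy =>
      obtain ⟨z', hz', a, e, rfl⟩ := hy
      by_cases hae : a + e = 0
      · obtain ⟨rfl, rfl⟩ : a = 0 ∧ e = 0 := by omega
        simpa [uu] using ih z' hz'
      · have h1 : sym z' * PP K n a e ∈ KL K n :=
          Submodule.mem_sup_right (Ideal.mul_mem_left _ _ (PP_mem (Nat.pos_of_ne_zero hae)))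
        rw [sym_mul_PP, ← Finset.sum_add_sum_compl B] at h1
        have h2 : ∑ j ∈ B, sym (z' * uu K j a e) ∈ KL K n := by
          refine Submodule.sum_mem _ fun j hj => ih _ (Subalgebra.mul_mem _ hz' (Subalgebra.mul_mem _
            (Subalgebra.pow_mem _ (Algebra.subset_adjoin ?_) _) (Subalgebra.pow_mem _ (Algebra.subset_adjoin ?_) _)))
          · exact ⟨j, hj, Or.inl rfl⟩
          · exact ⟨j, hj, Or.inr rfl⟩
        have h3 : ∀ j ∈ Bᶜ, sym (z' * uu K j a e) = sym (z' * uu K i a e) := by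
          intro j hj
          rw [Finset.mem_compl] at hj
          rw [← sym_act (Equiv.swap i j) (z' * uu K i a e), map_mul, permAct_uu, Equiv.swap_apply_left,
            permAct_fix _ B _ hz']
          intro k hk
          exact Equiv.swap_apply_of_ne_of_ne (by rintro rfl; exact hi hk) (by rintro rfl; exact hj hk)
        rw [Finset.sum_congr rfl h3, Finset.sum_const] at h1
        have h4 := (Submodule.add_mem_iff_right _ h2).1 h1
        rw [← Nat.cast_smul_eq_nsmul K] at h4
        refine (Submodule.smul_mem_iff _ ?_).1 h4
        rw [Nat.cast_ne_zero]
        exact (Finset.card_pos.2 ⟨i, by simpa using hi⟩).ne'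

lemma LL_mul_right {l : SuperRing K n} (hl : l ∈ LL K n) (y : SuperRing K n) : l * y ∈ LL K n := by
  have key : ∀ g ∈ gens K (Finset.univ : Finset (Fin n)), ∀ l ∈ LL K n, l * g ∈ LL K n := by
    intro g hg l hl
    induction hl using Submodule.span_induction with
    | zero => simp
    | add x y _ _ hx hy => rw [add_mul]; exact Ideal.add_mem _ hx hy
    | smul r x _ hx => rw [smul_eq_mul, mul_assoc]; exact Ideal.mul_mem_left _ _ hx
    | mem x hx =>
      obtain ⟨a, e, h, rfl⟩ := hx
      obtain ⟨j, -, rfl | rfl⟩ := hg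
      · rw [← xx_comm]; exact Ideal.mul_mem_left _ _ (PP_mem h)
      · have : PP K n a e * th K j = ((-1 : K) ^ e • th K j) * PP K n a e := by
          rw [PP, Finset.sum_mul, Finset.mul_sum]
          refine Finset.sum_congr rfl fun i _ => ?_
          have hc : xx K i ^ a * th K j = th K j * xx K i ^ a :=
              (show Commute (xx K i) (th K j) from xx_comm i _).pow_left a
          rw [uu, mul_assoc, th_pow_mul, mul_smul_comm, ← mul_assoc (xx K i ^ a), hc, smul_mul_assoc]
          simp only [mul_assoc]
        rw [this]
        exact Ideal.mul_mem_left _ _ (PP_mem h)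
  have hy : y ∈ Algebra.adjoin K (gens K (Finset.univ : Finset (Fin n))) := by
    rw [adjoin_gens_univ]; trivial
  induction hy using Algebra.adjoin_induction generalizing l with
  | mem g hg => exact key g hg l hl
  | algebraMap r => rw [← Algebra.commutes]; exact Ideal.mul_mem_left _ _ hl
  | add x y _ _ hx hy => rw [mul_add]; exact Ideal.add_mem _ (hx hl) (hy hl)
  | mul x y _ _ hx hy => rw [← mul_assoc]; exact hy (hx hl)

lemma aug_PP {a e : ℕ} (h : 0 < a + e) : superAug K n (PP K n a e) = 0 := by
  rw [PP, map_sum]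
  refine Finset.sum_eq_zero fun i _ => ?_
  rw [uu, map_mul, map_pow, map_pow]
  have h1 : superAug K n (xx K i) = 0 := by simp [superAug, xx]
  have h2 : superAug K n (th K i) = 0 := by simp [superAug, th, ExteriorAlgebra.algebraMapInv]
  rw [h1, h2, ← pow_add, zero_pow h.ne']

lemma aug_LL {l : SuperRing K n} (hl : l ∈ LL K n) : superAug K n l = 0 := by
  induction hl using Submodule.span_induction with
  | zero => simp
  | add x y _ _ hx hy => rw [map_add, hx, hy, add_zero]
  | smul r x _ hx => rw [smul_eq_mul, map_mul, hx, mul_zero]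
  | mem x hx =>
    obtain ⟨a, e, h, rfl⟩ := hx
    exact aug_PP h

lemma inv_mem_LL [CharZero K] {g : SuperRing K n} (hg : g ∈ superInv0 K n) : g ∈ LL K n := by
  obtain ⟨h1, h2⟩ := hg
  have h3 := sym_mem Finset.univ g (by rw [adjoin_gens_univ]; trivial)
  have h4 : sym g = (Fintype.card (Equiv.Perm (Fin n)) : K) • g := by
    rw [sym, Finset.sum_congr rfl (fun w _ => h1 w), Finset.sum_const, Nat.cast_smul_eq_nsmul, Finset.card_univ]
  have hne : (Fintype.card (Equiv.Perm (Fin n)) : K) ≠ 0 := Nat.cast_ne_zero.2 Fintype.card_ne_zero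
  rw [h4, Submodule.smul_mem_iff _ hne] at h3
  obtain ⟨c, hc, l, hl, rfl⟩ := Submodule.mem_sup.1 h3
  obtain ⟨r, rfl⟩ := Submodule.mem_span_singleton.1 hc
  rw [map_add, aug_LL hl, add_zero, map_smul, map_one, smul_eq_mul, mul_one] at h2
  rw [h2, zero_smul, zero_add]
  exact hl

lemma superIdeal_le [CharZero K] : superIdeal K n ≤ (LL K n).restrictScalars K := by
  rw [superIdeal, Submodule.span_le]
  rintro _ ⟨x, g, y, hg, rfl⟩
  exact LL_mul_right (Ideal.mul_mem_left _ _ (inv_mem_LL hg)) y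

lemma PP_mem_superIdeal {a e : ℕ} (h : 0 < a + e) (x y : SuperRing K n) :
    x * PP K n a e * y ∈ superIdeal K n :=
  Submodule.subset_span ⟨x, _, y, ⟨fun w => permAct_PP w a e, aug_PP h⟩, rfl⟩
end
end SArt

namespace SArt
section
variable {K : Type*} [Field K] {n : ℕ}

def detAlt (K : Type*) [Field K] {n : ℕ} (d : ℕ) :
    (Fin d → MvPolynomial (Fin n) K) [⋀^Fin d]→ₗ[K] MvPolynomial (Fin n) K :=
  { MultilinearMap.restrictScalars K
      (Matrix.detRowAlternating (n := Fin d) (R := MvPolynomial (Fin n) K)).toMultilinearMap with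
    map_eq_zero_of_eq' := fun v i j h hij =>
      (Matrix.detRowAlternating (n := Fin d) (R := MvPolynomial (Fin n) K)).map_eq_zero_of_eq v h hij }

lemma detAlt_apply (d : ℕ) (v : Fin d → Fin d → MvPolynomial (Fin n) K) :
    detAlt K d v = Matrix.det (Matrix.of v) := rfl

def rowMap {d : ℕ} (G : Fin d → Fin n → MvPolynomial (Fin n) K) :
    (Fin n → K) →ₗ[K] (Fin d → MvPolynomial (Fin n) K) where
  toFun v b := ∑ j, v j • G b j
  map_add' v w := by ext1 b; simp [add_smul, Finset.sum_add_distrib]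
  map_smul' r v := by ext1 b; simp [mul_smul, Finset.smul_sum]

lemma rowMap_single {d : ℕ} (G : Fin d → Fin n → MvPolynomial (Fin n) K) (j : Fin n) (b : Fin d) :
    rowMap G (Pi.single j 1) b = G b j := by
  simp [rowMap, Pi.single_apply]

def LG {d : ℕ} (G : Fin d → Fin n → MvPolynomial (Fin n) K) :
    ExteriorAlgebra K (Fin n → K) →ₗ[K] MvPolynomial (Fin n) K :=
  ExteriorAlgebra.liftAlternating
    (Pi.single (M := fun k => (Fin n → K) [⋀^Fin k]→ₗ[K] MvPolynomial (Fin n) K) d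
      ((detAlt K d).compLinearMap (rowMap G)))

lemma LG_same {d : ℕ} (G : Fin d → Fin n → MvPolynomial (Fin n) K) (v : Fin d → Fin n → K) :
    LG G (ExteriorAlgebra.ιMulti K d v) = Matrix.det (Matrix.of fun a b => rowMap G (v a) b) := by
  rw [LG, ExteriorAlgebra.liftAlternating_apply_ιMulti, Pi.single_eq_same]; rfl

lemma LG_ne {d k : ℕ} (h : k ≠ d) (G : Fin d → Fin n → MvPolynomial (Fin n) K) (v : Fin k → Fin n → K) :
    LG G (ExteriorAlgebra.ιMulti K k v) = 0 := by
  rw [LG, ExteriorAlgebra.liftAlternating_apply_ιMulti, Pi.single_eq_of_ne h]; rfl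

def Phi {d : ℕ} (G : Fin d → Fin n → MvPolynomial (Fin n) K) : SuperRing K n →ₗ[K] MvPolynomial (Fin n) K :=
  LinearMap.mul' K _ ∘ₗ TensorProduct.map LinearMap.id (LG G)

lemma Phi_tmul {d : ℕ} (G : Fin d → Fin n → MvPolynomial (Fin n) K) (p : MvPolynomial (Fin n) K)
    (l : ExteriorAlgebra K (Fin n → K)) : Phi G (p ⊗ₜ[K] l) = p * LG G l := by
  simp [Phi]

lemma uu_zero (j : Fin n) (a : ℕ) : uu K j a 0 = (X j ^ a) ⊗ₜ[K] 1 := by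
  simp [uu, xx, Algebra.TensorProduct.tmul_pow]

lemma uu_one (j : Fin n) (a : ℕ) : uu K j a 1 = (X j ^ a) ⊗ₜ[K] ExteriorAlgebra.ι K (Pi.single j (1 : K)) := by
  simp [uu, xx, th, Algebra.TensorProduct.tmul_pow]

lemma uu_two (j : Fin n) (a e : ℕ) : uu K j a (e + 2) = 0 := by
  rw [uu, pow_add, pow_two, th_sq, mul_zero, mul_zero]

lemma ιMulti_snoc {k : ℕ} (v : Fin k → Fin n → K) (w : Fin n → K) :
    ExteriorAlgebra.ιMulti K k v * ExteriorAlgebra.ι K w =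
      ExteriorAlgebra.ιMulti K (k + 1) (Fin.snoc (α := fun _ => Fin n → K) v w) := by
  rw [ExteriorAlgebra.ιMulti_apply, ExteriorAlgebra.ιMulti_apply, List.ofFn_succ']
  simp [List.concat_eq_append]

lemma LG_mem {d : ℕ} (G : Fin d → Fin n → MvPolynomial (Fin n) K) (a : ℕ)
    (hG : ∀ b, ∑ j, X j ^ a * G b j ∈ pIdeal K n) (l : ExteriorAlgebra K (Fin n → K)) :
    ∑ j : Fin n, X j ^ a * LG G (l * ExteriorAlgebra.ι K (Pi.single j (1 : K))) ∈ pIdeal K n := by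
  have hl : l ∈ Submodule.span K (Set.range fun x : Σ n', (Fin n' → Fin n → K) => ExteriorAlgebra.ιMulti K x.1 x.2) := by
    rw [ExteriorAlgebra.ιMulti_span]; trivial
  induction hl using Submodule.span_induction with
  | zero => simp
  | add x y _ _ hx hy =>
    simp only [add_mul, map_add, mul_add, Finset.sum_add_distrib]
    exact Ideal.add_mem _ hx hy
  | smul r x _ hx =>
    simp only [smul_mul_assoc, map_smul, mul_smul_comm, ← Finset.smul_sum]
    exact smul_mem_I r hx
  | mem x hx =>
    obtain ⟨⟨k, v⟩, rfl⟩ := hx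
    simp only [ιMulti_snoc]
    by_cases hk : k + 1 = d
    · subst hk
      simp only [LG_same]
      have : ∀ j : Fin n, Matrix.det (Matrix.of fun a b => rowMap G
            ((Fin.snoc (α := fun _ => Fin n → K) v (Pi.single j (1 : K)) : Fin (k + 1) → Fin n → K) a) b) =
          ∑ b : Fin (k + 1), G b j * ((-1) ^ (k + (b : ℕ)) * Matrix.det (Matrix.of fun (a : Fin k) (c : Fin k) =>
            rowMap G (v a) (b.succAbove c))) := by
        intro j
        rw [Matrix.det_succ_row _ (Fin.last k)]
        refine Finset.sum_congr rfl fun b _ => ?_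
        simp only [Matrix.of_apply, Fin.snoc_last, rowMap_single, Fin.val_last]
        rw [mul_comm _ (G b j), mul_assoc]
        congr 3
        ext1 a c
        simp [Matrix.submatrix_apply]
      simp only [this, Finset.mul_sum]
      rw [Finset.sum_comm]
      refine Ideal.sum_mem _ fun b _ => ?_
      simp only [← mul_assoc]
      rw [← Finset.sum_mul, ← Finset.sum_mul]
      exact Ideal.mul_mem_right _ _ (Ideal.mul_mem_right _ _ (hG b))
    · simp only [LG_ne hk, mul_zero, Finset.sum_const_zero]
      exact Ideal.zero_mem _

lemma Phi_mem {d : ℕ} (G : Fin d → Fin n → MvPolynomial (Fin n) K)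
    (hG : ∀ b a, ∑ j, X j ^ a * G b j ∈ pIdeal K n) {l : SuperRing K n} (hl : l ∈ LL K n) :
    Phi G l ∈ pIdeal K n := by
  have key : ∀ z, Phi G (z * l) ∈ pIdeal K n := by
    induction hl using Submodule.span_induction with
    | zero => simp
    | add x y _ _ hx hy => intro z; rw [mul_add, map_add]; exact Ideal.add_mem _ (hx z) (hy z)
    | smul r x _ hx => intro z; rw [smul_eq_mul, ← mul_assoc]; exact hx _
    | mem x hx =>
      obtain ⟨a, e, h, rfl⟩ := hx
      intro z
      induction z using TensorProduct.induction_on with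
      | zero => simp
      | add x y hx hy => rw [add_mul, map_add]; exact Ideal.add_mem _ hx hy
      | tmul p l =>
        rw [PP, Finset.mul_sum, map_sum]
        match e with
        | 0 =>
          simp only [uu_zero, Algebra.TensorProduct.tmul_mul_tmul, Phi_tmul, mul_one]
          rw [← Finset.sum_mul, ← Finset.mul_sum]
          refine Ideal.mul_mem_right _ _ (Ideal.mul_mem_left _ _ (Ideal.subset_span ⟨a - 1, ?_⟩))
          simp only
          rw [Nat.sub_add_cancel (by omega)]
        | 1 =>
          simp only [uu_one, Algebra.TensorProduct.tmul_mul_tmul, Phi_tmul, mul_assoc]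
          rw [← Finset.mul_sum]
          exact Ideal.mul_mem_left _ _ (LG_mem G a (fun b => hG b a) l)
        | e + 2 => simp [uu_two]
  simpa using key 1

lemma thetaMon_eq (J : Finset (Fin n)) {d : ℕ} (h : J.card = d) :
    thetaMon K n J = ExteriorAlgebra.ιMulti K d (fun a => Pi.single (J.orderEmbOfFin h a) 1) := by
  rw [thetaMon, ExteriorAlgebra.ιMulti_apply]
  congr 1
  subst h
  refine List.ext_getElem (by simp) fun i h1 h2 => ?_
  simp [Finset.orderEmbOfFin_apply]

def gg (K : Type*) [Field K] {n : ℕ} (b j : Fin n) : MvPolynomial (Fin n) K :=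
  X j * ∏ l ∈ Finset.Ioi b, (X j - X l)

lemma gg_zero {b j : Fin n} (h : b < j) : gg K b j = 0 := by
  rw [gg, Finset.prod_eq_zero (i := j) (by simpa using h) (by simp), mul_zero]

lemma gg_mem (b : Fin n) (a : ℕ) : ∑ j, X j ^ a * gg K b j ∈ pIdeal K n := by
  have := sum_eval_mem (K := K) (Polynomial.X ^ a * ∏ l ∈ Finset.Ioi b, (Polynomial.X - Polynomial.C (X l)))
  convert this using 1
  refine Finset.sum_congr rfl fun j _ => ?_
  simp [gg, Polynomial.eval_prod]
  ring

def PhiJ (K : Type*) [Field K] {n : ℕ} (J : Finset (Fin n)) : SuperRing K n →ₗ[K] MvPolynomial (Fin n) K :=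
  Phi (fun b : Fin J.card => gg K (J.orderEmbOfFin rfl b))

lemma PhiJ_mem [CharZero K] (J : Finset (Fin n)) {z : SuperRing K n} (hz : z ∈ superIdeal K n) : PhiJ K J z ∈ pIdeal K n :=
  Phi_mem _ (fun _ a => gg_mem _ a) (superIdeal_le hz)

lemma PhiJ_self (J : Finset (Fin n)) (p : MvPolynomial (Fin n) K) :
    PhiJ K J (p ⊗ₜ[K] thetaMon K n J) = fJ K J * p := by
  rw [PhiJ, Phi_tmul, thetaMon_eq J rfl, LG_same, mul_comm]
  congr 1
  simp only [rowMap_single]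
  rw [Matrix.det_of_upperTriangular]
  · rw [fJ]
    simp only [Matrix.of_apply, gg]
    conv_rhs => rw [← Finset.map_orderEmbOfFin_univ J rfl, Finset.prod_map]
    rfl
  · intro a b hab
    exact gg_zero (by simpa using hab)

def wt (J : Finset (Fin n)) : ℕ := ∑ j ∈ J, (j : ℕ)

lemma wt_eq (J : Finset (Fin n)) {d : ℕ} (h : J.card = d) : wt J = ∑ a, (J.orderEmbOfFin h a : ℕ) := by
  conv_lhs => rw [wt, ← Finset.map_orderEmbOfFin_univ J h, Finset.sum_map]
  rfl

lemma PhiJ_other (J J' : Finset (Fin n)) (p : MvPolynomial (Fin n) K) (hne : J' ≠ J) (hwt : wt J ≤ wt J') :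
    PhiJ K J (p ⊗ₜ[K] thetaMon K n J') = 0 := by
  rw [PhiJ, Phi_tmul]
  by_cases hc : J'.card = J.card
  · rw [thetaMon_eq J' hc, LG_same]
    simp only [rowMap_single]
    rw [Matrix.det_apply, Finset.sum_eq_zero, mul_zero]
    intro σ _
    by_contra hcon
    have hall : ∀ a, (J'.orderEmbOfFin hc (σ a) : ℕ) ≤ J.orderEmbOfFin rfl a := by
      intro a
      by_contra hlt
      apply hcon
      rw [Finset.prod_eq_zero (Finset.mem_univ a), smul_zero]
      exact gg_zero (by simpa using hlt)
    have hsum : ∑ a, (J'.orderEmbOfFin hc (σ a) : ℕ) = ∑ a, (J.orderEmbOfFin rfl a : ℕ) := by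
      apply le_antisymm (Finset.sum_le_sum fun a _ => hall a)
      rw [Equiv.sum_comp σ (fun a => (J'.orderEmbOfFin hc a : ℕ)), ← wt_eq, ← wt_eq]
      exact hwt
    have heq := (Finset.sum_eq_sum_iff_of_le (fun a _ => hall a)).1 hsum
    apply hne
    apply Finset.eq_of_subset_of_card_le _ hc.ge
    intro j hj
    rw [← Finset.map_orderEmbOfFin_univ J' hc] at hj
    simp only [Finset.mem_map, Finset.mem_univ, true_and] at hj
    obtain ⟨a, rfl⟩ := hj
    have := heq (σ.symm a) (Finset.mem_univ _)
    rw [Equiv.apply_symm_apply] at this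
    have h3 := Fin.ext this
    change J'.orderEmbOfFin hc a ∈ J
    rw [h3]
    exact Finset.orderEmbOfFin_mem J rfl _
  · rw [thetaMon_eq J' rfl, LG_ne hc, mul_zero]

/-- A relation among Artin monomials modulo the ideal is trivial. -/
theorem indep_super [CharZero K] (s : Finset (Finset (Fin n) × (Fin n → ℕ)))
    (hs : ∀ m ∈ s, ∀ i, m.2 i < stair m.1 i) (c : Finset (Fin n) × (Fin n → ℕ) → K)
    (h : ∑ m ∈ s, c m • (mon K m.2 ⊗ₜ[K] thetaMon K n m.1) ∈ superIdeal K n) : ∀ m ∈ s, c m = 0 := by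
  classical
  have key : ∀ N : ℕ, ∀ m ∈ s, wt m.1 = N → c m = 0 := by
    intro N
    induction N using Nat.strong_induction_on with
    | _ N ih =>
      rintro ⟨J, a⟩ hm hN
      have h1 := PhiJ_mem J h
      rw [map_sum] at h1
      have h2 : ∑ m ∈ s, PhiJ K J (c m • (mon K m.2 ⊗ₜ[K] thetaMon K n m.1)) =
          fJ K J * ∑ b ∈ (s.filter (fun m => m.1 = J)).image Prod.snd, c (J, b) • mon K b := by
        rw [Finset.sum_image, Finset.mul_sum, Finset.sum_filter]
        · refine Finset.sum_congr rfl fun m hms => ?_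
          rw [map_smul]
          split_ifs with hmJ
          · obtain ⟨J', b⟩ := m
            simp only at hmJ
            subst hmJ
            rw [PhiJ_self, mul_smul_comm]
          · by_cases hw : wt m.1 < N
            · rw [ih _ hw m hms rfl, zero_smul]
            · rw [PhiJ_other J m.1 _ hmJ (by simp only at hN; omega), smul_zero]
        · rintro ⟨J1, b1⟩ h1 ⟨J2, b2⟩ h2 h3
          simp only [Finset.coe_filter, Set.mem_ofPred_eq] at h1 h2 h3
          rw [h1.2, h2.2, h3]
      rw [h2] at h1
      refine indep J _ ?_ (fun b => c (J, b)) h1 a ?_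
      · intro b hb
        simp only [Finset.mem_image, Finset.mem_filter] at hb
        obtain ⟨m, ⟨hms, rfl⟩, rfl⟩ := hb
        exact hs m hms
      · simp only [Finset.mem_image, Finset.mem_filter]
        exact ⟨(J, a), ⟨hm, rfl⟩, rfl⟩
  exact fun m hm => key _ m hm rfl

end
end SArt

namespace SArt
section
variable {K : Type*} [Field K] {n : ℕ}

def gth (K : Type*) [Field K] {n : ℕ} (j : Fin n) : ExteriorAlgebra K (Fin n → K) :=
  ExteriorAlgebra.ι K (Pi.single j (1 : K))

lemma gth_sq (i : Fin n) : gth K i * gth K i = 0 := by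
  simp [gth]

lemma gth_anti (i j : Fin n) : gth K i * gth K j = (-1 : K) • (gth K j * gth K i) := by
  have := ExteriorAlgebra.ι_add_mul_swap (R := K) (Pi.single i (1 : K)) (Pi.single j (1 : K) : Fin n → K)
  rw [gth, gth, eq_neg_of_add_eq_zero_left this, ← neg_one_smul K]

lemma perm_prod {L L' : List (Fin n)} (h : L.Perm L') :
    ∃ r : K, r ≠ 0 ∧ (L.map (gth K)).prod = r • (L'.map (gth K)).prod := by
  induction h with
  | nil => exact ⟨1, one_ne_zero, by simp⟩
  | cons x _ ih =>
    obtain ⟨r, hr, h⟩ := ih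
    exact ⟨r, hr, by simp only [List.map_cons, List.prod_cons, h, mul_smul_comm]⟩
  | swap x y l =>
    refine ⟨-1, by simp, ?_⟩
    simp only [List.map_cons, List.prod_cons]
    rw [← mul_assoc, gth_anti, smul_mul_assoc, mul_assoc]
  | trans _ _ ih1 ih2 =>
    obtain ⟨r, hr, h⟩ := ih1
    obtain ⟨r', hr', h'⟩ := ih2
    exact ⟨r * r', mul_ne_zero hr hr', by rw [h, h', smul_smul]⟩

lemma thetaMon_gth (J : Finset (Fin n)) : thetaMon K n J = ((J.sort (· ≤ ·)).map (gth K)).prod := rfl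

lemma gth_mul_notMem {J : Finset (Fin n)} {l : Fin n} (hl : l ∉ J) :
    ∃ r : K, r ≠ 0 ∧ gth K l * thetaMon K n J = r • thetaMon K n (insert l J) := by
  have hp : (l :: J.sort (· ≤ ·)).Perm ((insert l J).sort (· ≤ ·)) := by
    refine (List.perm_ext_iff_of_nodup ?_ (Finset.sort_nodup _ _)).2 ?_
    · simp [hl]
    · intro a; simp
  obtain ⟨r, hr, h⟩ := perm_prod (K := K) hp
  exact ⟨r, hr, by rw [thetaMon_gth, thetaMon_gth, ← h, List.map_cons, List.prod_cons]⟩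

lemma gth_mul_mem {J : Finset (Fin n)} {l : Fin n} (hl : l ∈ J) : gth K l * thetaMon K n J = 0 := by
  obtain ⟨r, hr, h⟩ := gth_mul_notMem (K := K) (Finset.notMem_erase l J)
  rw [Finset.insert_erase hl] at h
  have : thetaMon K n J = r⁻¹ • (gth K l * thetaMon K n (J.erase l)) := by
    rw [h, smul_smul, inv_mul_cancel₀ hr, one_smul]
  rw [this, mul_smul_comm, ← mul_assoc, gth_sq, zero_mul, smul_zero]

lemma theta_span : Submodule.span K (Set.range (thetaMon K n)) = ⊤ := by
  rw [eq_top_iff]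
  have key : ∀ x : ExteriorAlgebra K (Fin n → K), ∀ w ∈ Submodule.span K (Set.range (thetaMon K n)),
      x * w ∈ Submodule.span K (Set.range (thetaMon K n)) := by
    intro x
    induction x using ExteriorAlgebra.induction with
    | algebraMap r => intro w hw; rw [← Algebra.smul_def]; exact Submodule.smul_mem _ _ hw
    | mul a b ha hb => intro w hw; rw [mul_assoc]; exact ha _ (hb _ hw)
    | add a b ha hb => intro w hw; rw [add_mul]; exact Submodule.add_mem _ (ha _ hw) (hb _ hw)
    | ι v =>
      intro w hw
      have hv : v = ∑ i, v i • Pi.single i (1 : K) := by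
        ext j; simp [Finset.sum_apply, Pi.single_apply]
      have hv2 : ExteriorAlgebra.ι K v = ∑ i, v i • gth K i := by
        conv_lhs => rw [hv]
        simp only [map_sum, map_smul, gth]
      rw [hv2, Finset.sum_mul]
      refine Submodule.sum_mem _ fun i _ => ?_
      rw [smul_mul_assoc]
      refine Submodule.smul_mem _ _ ?_
      induction hw using Submodule.span_induction with
      | zero => simp
      | add x y _ _ hx hy => rw [mul_add]; exact Submodule.add_mem _ hx hy
      | smul r x _ hx => rw [mul_smul_comm]; exact Submodule.smul_mem _ _ hx
      | mem x hx =>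
        obtain ⟨J, rfl⟩ := hx
        by_cases hi : i ∈ J
        · rw [gth_mul_mem hi]; exact Submodule.zero_mem _
        · obtain ⟨r, _, h⟩ := gth_mul_notMem (K := K) hi
          rw [h]; exact Submodule.smul_mem _ _ (Submodule.subset_span ⟨_, rfl⟩)
  intro x _
  have h1 : (1 : ExteriorAlgebra K (Fin n → K)) ∈ Submodule.span K (Set.range (thetaMon K n)) :=
    Submodule.subset_span ⟨∅, by simp [thetaMon]⟩
  simpa using key x 1 h1

lemma mem_of_tmul (W : Submodule K (SuperRing K n)) (h : ∀ p J, p ⊗ₜ[K] thetaMon K n J ∈ W) : W = ⊤ := by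
  rw [eq_top_iff]
  intro z _
  induction z using TensorProduct.induction_on with
  | zero => exact W.zero_mem
  | add x y hx hy => exact W.add_mem (hx trivial) (hy trivial)
  | tmul p l =>
    have hl : l ∈ Submodule.span K (Set.range (thetaMon K n)) := by rw [theta_span]; trivial
    rename_i hz
    clear hz
    induction hl using Submodule.span_induction with
    | zero => rw [TensorProduct.tmul_zero]; exact W.zero_mem
    | add x y _ _ hx hy => rw [TensorProduct.tmul_add]; exact W.add_mem hx hy
    | smul r x _ hx => rw [TensorProduct.tmul_smul]; exact W.smul_mem _ hx
    | mem x hx => obtain ⟨J, rfl⟩ := hx; exact h p J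

def Fil (K : Type*) [Field K] (n : ℕ) (N : ℕ) : Submodule K (SuperRing K n) :=
  superIdeal K n ⊔ Submodule.span K {z | ∃ q J, N < wt J ∧ z = q ⊗ₜ[K] thetaMon K n J}

lemma superIdeal_mul (x : SuperRing K n) {z : SuperRing K n} (hz : z ∈ superIdeal K n) :
    x * z ∈ superIdeal K n := by
  unfold superIdeal at hz
  induction hz using Submodule.span_induction with
  | zero => rw [mul_zero]; exact Submodule.zero_mem _
  | add a b _ _ ha hb => rw [mul_add]; exact Submodule.add_mem _ ha hb
  | smul r a _ ha => rw [mul_smul_comm]; exact Submodule.smul_mem _ _ ha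
  | mem a ha =>
    obtain ⟨u, g, y, hg, rfl⟩ := ha
    exact Submodule.subset_span ⟨x * u, g, y, hg, by simp only [mul_assoc]⟩

lemma Fil_mul (N : ℕ) (p : MvPolynomial (Fin n) K) {z : SuperRing K n} (hz : z ∈ Fil K n N) :
    (p ⊗ₜ[K] 1) * z ∈ Fil K n N := by
  unfold Fil at hz
  obtain ⟨a, ha, b, hb, rfl⟩ := Submodule.mem_sup.1 hz
  rw [mul_add]
  refine Submodule.add_mem _ (Submodule.mem_sup_left (superIdeal_mul _ ha)) (Submodule.mem_sup_right ?_)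
  clear hz
  induction hb using Submodule.span_induction with
  | zero => rw [mul_zero]; exact Submodule.zero_mem _
  | add a b _ _ ha hb => rw [mul_add]; exact Submodule.add_mem _ ha hb
  | smul r a _ ha => rw [mul_smul_comm]; exact Submodule.smul_mem _ _ ha
  | mem a ha =>
    obtain ⟨q, J, h, rfl⟩ := ha
    exact Submodule.subset_span ⟨p * q, J, h, by simp⟩

def bJ (K : Type*) [Field K] {n : ℕ} (J : Finset (Fin n)) : Ideal (MvPolynomial (Fin n) K) where
  carrier := {p | p ⊗ₜ[K] thetaMon K n J ∈ Fil K n (wt J)}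
  zero_mem' := by
    change (0 : MvPolynomial (Fin n) K) ⊗ₜ[K] thetaMon K n J ∈ Fil K n (wt J)
    rw [TensorProduct.zero_tmul]; exact Submodule.zero_mem _
  add_mem' := by
    intro a b ha hb
    change (a + b) ⊗ₜ[K] thetaMon K n J ∈ Fil K n (wt J)
    rw [TensorProduct.add_tmul]; exact Submodule.add_mem _ ha hb
  smul_mem' := by
    intro c p hp
    change (c * p) ⊗ₜ[K] thetaMon K n J ∈ Fil K n (wt J)
    have := Fil_mul (wt J) c hp
    simpa using this

lemma mem_bJ {J : Finset (Fin n)} {p : MvPolynomial (Fin n) K} :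
    p ∈ bJ K J ↔ p ⊗ₜ[K] thetaMon K n J ∈ Fil K n (wt J) := Iff.rfl

lemma pIdeal_le_bJ (J : Finset (Fin n)) : pIdeal K n ≤ bJ K J := by
  unfold pIdeal
  refine Ideal.span_le.2 ?_
  rintro _ ⟨r, rfl⟩
  refine Submodule.mem_sup_left ?_
  have := PP_mem_superIdeal (K := K) (n := n) (a := r + 1) (e := 0) (by omega) 1 (1 ⊗ₜ[K] thetaMon K n J)
  convert this using 1
  simp only [PP, uu_zero, one_mul, Finset.sum_mul, Algebra.TensorProduct.tmul_mul_tmul, mul_one,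
    TensorProduct.sum_tmul]

lemma poly_theta_mem (Q : Polynomial (MvPolynomial (Fin n) K)) (w : ExteriorAlgebra K (Fin n → K)) :
    ∑ l : Fin n, (Q.eval (X l)) ⊗ₜ[K] (gth K l * w) ∈ superIdeal K n := by
  induction Q using Polynomial.induction_on' with
  | add p q hp hq =>
    simp only [Polynomial.eval_add, TensorProduct.add_tmul, Finset.sum_add_distrib]
    exact Submodule.add_mem _ hp hq
  | monomial r c =>
    have := PP_mem_superIdeal (K := K) (n := n) (a := r) (e := 1) (by omega) (c ⊗ₜ[K] 1) (1 ⊗ₜ[K] w)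
    convert this using 1
    simp only [PP, uu_one, Finset.mul_sum, Finset.sum_mul, Algebra.TensorProduct.tmul_mul_tmul, mul_one,
      one_mul, Polynomial.eval_monomial, gth]

lemma prod_mem_bJ (J : Finset (Fin n)) {i : Fin n} (hi : i ∈ J) :
    ∏ l ∈ Finset.univ.filter (fun l => l < i ∧ l ∉ J), (X i - X l) ∈ bJ K J := by
  set Q : Polynomial (MvPolynomial (Fin n) K) :=
    ∏ l ∈ Finset.univ.filter (fun l => l < i ∧ l ∉ J), (Polynomial.X - Polynomial.C (X l)) with hQ
  have hev : ∀ l, Q.eval (X l) = ∏ k ∈ Finset.univ.filter (fun k => k < i ∧ k ∉ J), (X l - X k) := by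
    intro l; simp [hQ, Polynomial.eval_prod]
  have h := poly_theta_mem Q (thetaMon K n (J.erase i))
  rw [← Finset.add_sum_erase _ _ (Finset.mem_univ i)] at h
  have hrest : ∑ l ∈ Finset.univ.erase i, (Q.eval (X l)) ⊗ₜ[K] (gth K l * thetaMon K n (J.erase i)) ∈
      Fil K n (wt J) := by
    refine Submodule.sum_mem _ fun l hl => ?_
    have hli : l ≠ i := Finset.ne_of_mem_erase hl
    by_cases hlJ : l ∈ J
    · rw [gth_mul_mem (Finset.mem_erase.2 ⟨hli, hlJ⟩), TensorProduct.tmul_zero]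
      exact Submodule.zero_mem _
    · rcases lt_or_gt_of_ne hli with h1 | h1
      · have : Q.eval (X l) = 0 := by
          rw [hev]
          exact Finset.prod_eq_zero (i := l) (by simp [h1, hlJ]) (sub_self _)
        rw [this, TensorProduct.zero_tmul]; exact Submodule.zero_mem _
      · have hl2 : l ∉ J.erase i := fun h => hlJ (Finset.mem_of_mem_erase h)
        obtain ⟨r, _, h⟩ := gth_mul_notMem (K := K) hl2
        rw [h, TensorProduct.tmul_smul]
        refine Submodule.smul_mem _ _ (Submodule.mem_sup_right (Submodule.subset_span ⟨_, _, ?_, rfl⟩))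
        rw [wt, wt, Finset.sum_insert hl2, ← Finset.add_sum_erase J _ hi]
        have : (i : ℕ) < l := h1
        omega
  obtain ⟨r, hr, hg⟩ := gth_mul_notMem (K := K) (Finset.notMem_erase i J)
  rw [Finset.insert_erase hi] at hg
  have h2 : Q.eval (X i) ⊗ₜ[K] (gth K i * thetaMon K n (J.erase i)) ∈ Fil K n (wt J) :=
    (Submodule.add_mem_iff_left _ hrest).1 (Submodule.mem_sup_left h)
  rw [hg, TensorProduct.tmul_smul, Submodule.smul_mem_iff _ hr, hev] at h2
  exact h2

lemma wt_le (J : Finset (Fin n)) : wt J ≤ wt (Finset.univ : Finset (Fin n)) :=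
  Finset.sum_le_sum_of_subset (Finset.subset_univ J)

theorem span_super [CharZero K] (hn : 0 < n) :
    ∃ T : Finset (SuperRing K n), T.card ≤ ∑ J : Finset (Fin n), ∏ i, stair J i ∧
      superIdeal K n ⊔ Submodule.span K (T : Set (SuperRing K n)) = ⊤ := by
  classical
  obtain ⟨m, rfl⟩ : ∃ m, n = m + 1 := ⟨n - 1, by omega⟩
  have hcov : ∀ J : Finset (Fin (m + 1)), Cov K (bJ K J) (∏ i, stair J i) := fun J =>
    upperS J (bJ K J) (pIdeal_le_bJ J) (fun i hi => prod_mem_bJ J hi)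
  choose B hB hB2 using hcov
  refine ⟨Finset.univ.biUnion fun J => (B J).image fun b => b ⊗ₜ[K] thetaMon K (m + 1) J, ?_, ?_⟩
  · refine Finset.card_biUnion_le.trans (Finset.sum_le_sum fun J _ => Finset.card_image_le.trans (hB J))
  · set T := Finset.univ.biUnion fun J => (B J).image fun b => b ⊗ₜ[K] thetaMon K (m + 1) J with hT
    refine mem_of_tmul _ ?_
    have key : ∀ N : ℕ, ∀ J : Finset (Fin (m + 1)), wt (Finset.univ : Finset (Fin (m + 1))) - wt J = N →
        ∀ p, p ⊗ₜ[K] thetaMon K (m + 1) J ∈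
          superIdeal K (m + 1) ⊔ Submodule.span K (T : Set (SuperRing K (m + 1))) := by
      intro N
      induction N using Nat.strong_induction_on with
      | _ N ih =>
        intro J hJ p
        have hF : Fil K (m + 1) (wt J) ≤
            superIdeal K (m + 1) ⊔ Submodule.span K (T : Set (SuperRing K (m + 1))) := by
          refine sup_le le_sup_left (Submodule.span_le.2 ?_)
          rintro _ ⟨q, J', h, rfl⟩
          have := wt_le J'
          exact ih _ (by omega) J' rfl q
        obtain ⟨w, hw, hpw⟩ := hB2 J p
        have e : p = (p - w) + w := by ring
        rw [e, TensorProduct.add_tmul]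
        refine Submodule.add_mem _ (hF hpw) (Submodule.mem_sup_right ?_)
        clear hpw e
        induction hw using Submodule.span_induction with
        | zero => rw [TensorProduct.zero_tmul]; exact Submodule.zero_mem _
        | add a b _ _ ha hb => rw [TensorProduct.add_tmul]; exact Submodule.add_mem _ ha hb
        | smul r a _ ha => rw [← TensorProduct.smul_tmul']; exact Submodule.smul_mem _ _ ha
        | mem b hb =>
          refine Submodule.subset_span ?_
          rw [Finset.mem_coe, hT, Finset.mem_biUnion]
          exact ⟨J, Finset.mem_univ J, Finset.mem_image_of_mem _ hb⟩
    exact fun p J => key _ J rfl p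

def artEquiv (n : ℕ) : { m : Finset (Fin n) × (Fin n → ℕ) // ∀ i, m.2 i < stair m.1 i } ≃
    (Σ J : Finset (Fin n), ∀ i, Fin (stair J i)) where
  toFun m := ⟨m.1.1, fun i => ⟨m.1.2 i, m.2 i⟩⟩
  invFun s := ⟨(s.1, fun i => (s.2 i : ℕ)), fun i => (s.2 i).2⟩
  left_inv _ := rfl
  right_inv _ := rfl

end
end SArt

/-- The superspace Artin monomials `x^a · θ_J`, with `a` fitting under the
`J`-staircase, descend to a `K`-basis of the superspace coinvariant ring
`SR = Ω / I`. -/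
theorem statement1 (K : Type*) [Field K] [CharZero K] (n : ℕ) (hn : 0 < n) :
    LinearIndependent K
      (fun m : { m : Finset (Fin n) × (Fin n → ℕ) // ∀ i, m.2 i < stair m.1 i } =>
        Submodule.Quotient.mk (p := superIdeal K n)
          ((monomial (Finsupp.equivFunOnFinite.symm m.1.2) (1 : K)) ⊗ₜ[K]
            thetaMon K n m.1.1)) ∧
    Submodule.span K
      (Set.range fun m : { m : Finset (Fin n) × (Fin n → ℕ) // ∀ i, m.2 i < stair m.1 i } =>
        Submodule.Quotient.mk (p := superIdeal K n)
          ((monomial (Finsupp.equivFunOnFinite.symm m.1.2) (1 : K)) ⊗ₜ[K]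
            thetaMon K n m.1.1)) = ⊤ := by
  classical
  have hli : LinearIndependent K
      (fun m : { m : Finset (Fin n) × (Fin n → ℕ) // ∀ i, m.2 i < stair m.1 i } =>
        Submodule.Quotient.mk (p := superIdeal K n)
          ((monomial (Finsupp.equivFunOnFinite.symm m.1.2) (1 : K)) ⊗ₜ[K]
            thetaMon K n m.1.1)) := by
    rw [linearIndependent_iff']
    intro s g hg m hm
    simp only [SArt.mon_eq, ← Submodule.mkQ_apply] at hg
    simp only [← map_smul, ← map_sum] at hg
    rw [Submodule.mkQ_apply, Submodule.Quotient.mk_eq_zero] at hg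
    have := SArt.indep_super (s.map (Function.Embedding.subtype _)) (by
      intro m' hm'
      rw [Finset.mem_map] at hm'
      obtain ⟨a, _, rfl⟩ := hm'
      exact a.2) (fun m' => if h : ∀ i, m'.2 i < stair m'.1 i then g ⟨m', h⟩ else 0) (by
        rw [Finset.sum_map]
        convert hg using 1
        refine Finset.sum_congr rfl fun a _ => ?_
        have ha : ∀ i, (Function.Embedding.subtype (fun m : Finset (Fin n) × (Fin n → ℕ) =>
          ∀ i, m.2 i < stair m.1 i) a).2 i < stair (Function.Embedding.subtype
            (fun m : Finset (Fin n) × (Fin n → ℕ) => ∀ i, m.2 i < stair m.1 i) a).1 i := a.2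
        rw [dif_pos ha]
        rfl) m.1 (by rw [Finset.mem_map]; exact ⟨m, hm, rfl⟩)
    rw [dif_pos m.2] at this
    exact this
  refine ⟨hli, ?_⟩
  haveI : Fintype { m : Finset (Fin n) × (Fin n → ℕ) // ∀ i, m.2 i < stair m.1 i } :=
    Fintype.ofEquiv _ (SArt.artEquiv n).symm
  have hcard : Fintype.card { m : Finset (Fin n) × (Fin n → ℕ) // ∀ i, m.2 i < stair m.1 i } =
      ∑ J : Finset (Fin n), ∏ i, stair J i := by
    rw [Fintype.card_congr (SArt.artEquiv n)]
    simp [Fintype.card_sigma, Fintype.card_pi]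
  obtain ⟨T, hT, hT2⟩ := SArt.span_super (K := K) hn
  have htop : Submodule.span K ((T.image (superIdeal K n).mkQ : Finset _) : Set (SuperRing K n ⧸ superIdeal K n)) = ⊤ := by
    rw [Finset.coe_image, ← Submodule.map_span]
    have := congrArg (Submodule.map (superIdeal K n).mkQ) hT2
    rw [Submodule.map_sup, Submodule.map_top, Submodule.range_mkQ, Submodule.mkQ_map_self, bot_sup_eq] at this
    exact this
  haveI : FiniteDimensional K (SuperRing K n ⧸ superIdeal K n) := ⟨⟨_, htop⟩⟩
  have hle : Module.finrank K (SuperRing K n ⧸ superIdeal K n) ≤ T.card := by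
    rw [← finrank_top, ← htop]
    exact (finrank_span_finset_le_card _).trans Finset.card_image_le
  have hge := hli.fintype_card_le_finrank
  exact hli.span_eq_top_of_card_eq_finrank' (by omega)
end
end
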